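/- arXiv:2009.06970 — 12 statements merged into one kernel-verified Lean document; each statement's English description precedes it below -/
import Mathlib

section
/- Let S be a (≤,∘)-structure and let θ be a (⊑,;)-representation of S over a base set X. Then for all a,b,s ∈ S: if a ◄ b then dom(θ(a)) ⊆ dom(θ(b)), and if a ◁^s b then θ(a)↾dom(θ(s)) ⊆ θ(b). -/
/-- Simultaneous recursive definition of the predicates `◄ₙ` (first component)
and `◁ˢₙ` (second component, parametrised by `s`). -/
def BT {S : Type*} (le : S → S → Prop) (op : S → S → S) :
    ℕ → (S → S → Prop) × (S → S → S → Prop)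
  | 0 =>
    (fun a b => le b a ∨ ∃ c, le (op b c) a,
     fun s a b => le a b ∧ s = b)
  | n + 1 =>
    (fun a b =>
        (BT le op n).2 a a b ∨
        (∃ c, (BT le op n).1 a c ∧ (BT le op n).1 c b) ∨
        (∃ d f f', a = op d f ∧ (BT le op n).1 f f' ∧ b = op d f'),
     fun s a b =>
        (∃ c, (BT le op n).2 s a c ∧ (BT le op n).2 s c b) ∨
        (∃ c c' d d', a = op c d ∧ (BT le op n).2 s c c' ∧
          (BT le op n).2 d d d' ∧ b = op c' d') ∨
        (∃ s', (BT le op n).2 s' a b ∧ (BT le op n).1 s s'))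

/-- `a ◄ₙ b` -/
def Bn {S : Type*} (le : S → S → Prop) (op : S → S → S) (n : ℕ) (a b : S) : Prop :=
  (BT le op n).1 a b

/-- `a ◁ˢₙ b` -/
def Tn {S : Type*} (le : S → S → Prop) (op : S → S → S) (n : ℕ) (s a b : S) : Prop :=
  (BT le op n).2 s a b

/-- `a ◄ b` -/
def Binf {S : Type*} (le : S → S → Prop) (op : S → S → S) (a b : S) : Prop :=
  ∃ n, Bn le op n a b

/-- `a ◁ˢ b` -/
def Tinf {S : Type*} (le : S → S → Prop) (op : S → S → S) (s a b : S) : Prop :=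
  ∃ n, Tn le op n s a b


/-- The domain of a binary relation. -/
def dom {X : Type*} (R : Set (X × X)) : Set X := {x | ∃ y, (x, y) ∈ R}

/-- Composition of binary relations. -/
def rcomp {X : Type*} (R S : Set (X × X)) : Set (X × X) :=
  {p | ∃ z, (p.1, z) ∈ R ∧ (z, p.2) ∈ S}

/-- Demonic refinement `R ⊑ S`. -/
def refines {X : Type*} (R S : Set (X × X)) : Prop :=
  dom S ⊆ dom R ∧ ∀ p ∈ R, p.1 ∈ dom S → p ∈ S

/-- A `(⊑, ;)`-representation of a `(≤, ∘)`-structure. -/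
def IsRepresentation {S X : Type*} (le : S → S → Prop) (op : S → S → S)
    (θ : S → Set (X × X)) : Prop :=
  (∀ a b, le a b ↔ refines (θ a) (θ b)) ∧ (∀ a b, θ (op a b) = rcomp (θ a) (θ b))

/-- A structure is representable if it has a `(⊑, ;)`-representation over some base set. -/
def Representable (S : Type*) (le : S → S → Prop) (op : S → S → S) : Prop :=
  ∃ (X : Type) (θ : S → Set (X × X)), IsRepresentation le op θ

/-- Stage-wise soundness of `◄ₙ` and `◁ˢₙ` in any representation. -/
theorem IsRepresentation.sound {S X : Type*} {le : S → S → Prop} {op : S → S → S}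
    {θ : S → Set (X × X)} (hθ : IsRepresentation le op θ) (n : ℕ) :
    (∀ a b, Bn le op n a b → dom (θ a) ⊆ dom (θ b)) ∧
    (∀ s a b, Tn le op n s a b → ∀ p ∈ θ a, p.1 ∈ dom (θ s) → p ∈ θ b) := by
  obtain ⟨hle, hop⟩ := hθ
  induction n with
  | zero =>
    refine ⟨?_, ?_⟩
    · rintro a b (h | ⟨c, h⟩)
      · exact ((hle _ _).1 h).1
      · intro x hx
        obtain ⟨y, hy⟩ := ((hle _ _).1 h).1 hx
        rw [hop] at hy
        obtain ⟨z, hz, -⟩ := hy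
        exact ⟨z, hz⟩
    · rintro s a b ⟨h, rfl⟩
      exact ((hle _ _).1 h).2
  | succ n ih =>
    obtain ⟨ihB, ihT⟩ := ih
    refine ⟨?_, ?_⟩
    · rintro a b (h | ⟨c, h₁, h₂⟩ | ⟨d, f, f', rfl, h, rfl⟩)
      · rintro x ⟨y, hy⟩
        exact ⟨y, ihT _ _ _ h _ hy ⟨y, hy⟩⟩
      · exact (ihB _ _ h₁).trans (ihB _ _ h₂)
      · rintro x ⟨y, hy⟩
        rw [hop] at hy
        obtain ⟨z, hxz, hzy⟩ := hy
        obtain ⟨w, hw⟩ := ihB _ _ h ⟨y, hzy⟩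
        refine ⟨w, ?_⟩
        rw [hop]
        exact ⟨z, hxz, hw⟩
    · rintro s a b (⟨c, h₁, h₂⟩ | ⟨c, c', d, d', rfl, h₁, h₂, rfl⟩ | ⟨s', h₁, h₂⟩) p hp hs
      · exact ihT _ _ _ h₂ _ (ihT _ _ _ h₁ _ hp hs) hs
      · rw [hop] at hp ⊢
        obtain ⟨z, hxz, hzy⟩ := hp
        exact ⟨z, ihT _ _ _ h₁ _ hxz hs, ihT _ _ _ h₂ _ hzy ⟨_, hzy⟩⟩
      · exact ihT _ _ _ h₁ _ hp (ihB _ _ h₂ hs)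

/-- Lemma 2: in any representation, `a ◄ b` implies `dom(θ a) ⊆ dom(θ b)`, and
`a ◁ˢ b` implies `θ a` restricted to `dom(θ s)` is contained in `θ b`. -/
theorem stmt4 {S X : Type*} (le : S → S → Prop) (op : S → S → S)
    (θ : S → Set (X × X)) (hθ : IsRepresentation le op θ) :
    ∀ a b s : S,
      (Binf le op a b → dom (θ a) ⊆ dom (θ b)) ∧
      (Tinf le op s a b → {p ∈ θ a | p.1 ∈ dom (θ s)} ⊆ θ b) := by
  intro a b s
  refine ⟨?_, ?_⟩
  · rintro ⟨n, h⟩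
    exact (hθ.sound n).1 a b h
  · rintro ⟨n, h⟩ p ⟨hp, hs⟩
    exact (hθ.sound n).2 s a b h p hp hs
end

section
/- Let S = (S,≤,∘) be a structure where ∘ is associative, ≤ is a partial order, and S satisfies σ. Let θ be the canonical map of Definition 3. Then for all a,b ∈ S: θ(a∘b) = θ(a);θ(b). -/
/-- The base set of Definition 3: `X_i ∪ X_f ∪ X_β`, where
`Sum.inl ⟨(d, s), _⟩` is the initial point `(dᵢ, sᵢ)` (requiring `d ◄ s`),
`Sum.inr (Sum.inl s)` is the following point `s_f`, and
`Sum.inr (Sum.inr d)` is the branch point `d_β`. -/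
def Base (S : Type*) (le : S → S → Prop) (op : S → S → S) : Type _ :=
  {p : S × S // Binf le op p.1 p.2} ⊕ (S ⊕ S)

def isIni {S : Type*} {le : S → S → Prop} {op : S → S → S} :
    Base S le op → Prop
  | Sum.inl _ => True
  | Sum.inr _ => False

def isFol {S : Type*} {le : S → S → Prop} {op : S → S → S} :
    Base S le op → Prop
  | Sum.inr (Sum.inl _) => True
  | _ => False

def isBeta {S : Type*} {le : S → S → Prop} {op : S → S → S} :
    Base S le op → Prop
  | Sum.inr (Sum.inr _) => True
  | _ => False

/-- The map `δ` of Definition 3. -/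
def delta {S : Type*} {le : S → S → Prop} {op : S → S → S} :
    Base S le op → S
  | Sum.inl p => p.val.1
  | Sum.inr (Sum.inl s) => s
  | Sum.inr (Sum.inr d) => d

/-- The map `λ` of Definition 3 (its value on branch points is irrelevant). -/
def lam {S : Type*} {le : S → S → Prop} {op : S → S → S} :
    Base S le op → S
  | Sum.inl p => p.val.2
  | Sum.inr (Sum.inl s) => s
  | Sum.inr (Sum.inr d) => d

/-- The canonical map `θ` of Definition 3: `(x, y) ∈ θ a` iff
(I) `y ∉ X_i`, (II) `x ∈ X_β → y ∈ X_β`, (III) `δ(x) ◄ a∘δ(y)`, and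
(IV) if `x ∈ X_i ∪ X_f` and `y ∈ X_f` then `λ(x) ◁^{δ(x)} a∘λ(y)`. -/
def theta {S : Type*} (le : S → S → Prop) (op : S → S → S) (a : S) :
    Set (Base S le op × Base S le op) :=
  {p | ¬ isIni p.2 ∧
       (isBeta p.1 → isBeta p.2) ∧
       Binf le op (delta p.1) (op a (delta p.2)) ∧
       (¬ isBeta p.1 → isFol p.2 →
         Tinf le op (delta p.1) (lam p.1) (op a (lam p.2)))}

section Refinement

variable {S : Type*} {le : S → S → Prop} {op : S → S → S}

theorem Bn.refl (hrefl : ∀ a, le a a) (n : ℕ) (a : S) : Bn le op n a a := by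
  induction n with
  | zero => exact Or.inl (hrefl a)
  | succ n ih => exact Or.inr (Or.inl ⟨a, ih, ih⟩)

theorem Bn.mono (hrefl : ∀ a, le a a) {m n : ℕ} (hmn : m ≤ n) {a b : S}
    (h : Bn le op m a b) : Bn le op n a b := by
  induction hmn with
  | refl => exact h
  | step _ ih => exact Or.inr (Or.inl ⟨b, ih, Bn.refl hrefl _ b⟩)

theorem Tn.mono (hrefl : ∀ a, le a a) {m n : ℕ} (hmn : m ≤ n) {s a b : S}
    (h : Tn le op m s a b) : Tn le op n s a b := by
  induction hmn with
  | refl => exact h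
  | step _ ih => exact Or.inr (Or.inr ⟨s, ih, Bn.refl hrefl _ s⟩)

theorem Binf.refl (hrefl : ∀ a, le a a) (a : S) : Binf le op a a :=
  ⟨0, Bn.refl hrefl 0 a⟩

theorem Binf.trans (hrefl : ∀ a, le a a) {a b c : S}
    (hab : Binf le op a b) (hbc : Binf le op b c) : Binf le op a c := by
  obtain ⟨m, hm⟩ := hab
  obtain ⟨n, hn⟩ := hbc
  exact ⟨max m n + 1, Or.inr (Or.inl
    ⟨b, hm.mono hrefl (le_max_left m n), hn.mono hrefl (le_max_right m n)⟩)⟩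

theorem Binf.op_left (d : S) {a b : S} (h : Binf le op a b) :
    Binf le op (op d a) (op d b) := by
  obtain ⟨n, hn⟩ := h
  exact ⟨n + 1, Or.inr (Or.inr ⟨d, a, b, rfl, hn, rfl⟩)⟩

theorem Binf.op_right (hrefl : ∀ a, le a a) (a b : S) : Binf le op (op a b) a :=
  ⟨0, Or.inr ⟨b, hrefl _⟩⟩

theorem Tinf.refl (hrefl : ∀ a, le a a) (a : S) : Tinf le op a a a :=
  ⟨0, hrefl a, rfl⟩

theorem Tinf.trans (hrefl : ∀ a, le a a) {s a b c : S}
    (hab : Tinf le op s a b) (hbc : Tinf le op s b c) : Tinf le op s a c := by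
  obtain ⟨m, hm⟩ := hab
  obtain ⟨n, hn⟩ := hbc
  exact ⟨max m n + 1, Or.inl
    ⟨b, hm.mono hrefl (le_max_left m n), hn.mono hrefl (le_max_right m n)⟩⟩

theorem Tinf.of_binf (hrefl : ∀ a, le a a) {s s' a b : S}
    (hs : Binf le op s s') (h : Tinf le op s' a b) : Tinf le op s a b := by
  obtain ⟨m, hm⟩ := hs
  obtain ⟨n, hn⟩ := h
  exact ⟨max m n + 1, Or.inr (Or.inr
    ⟨s', hn.mono hrefl (le_max_right m n), hm.mono hrefl (le_max_left m n)⟩)⟩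

theorem Tinf.op_op (hrefl : ∀ a, le a a) {s c c' d d' : S}
    (hc : Tinf le op s c c') (hd : Tinf le op d d d') :
    Tinf le op s (op c d) (op c' d') := by
  obtain ⟨m, hm⟩ := hc
  obtain ⟨n, hn⟩ := hd
  exact ⟨max m n + 1, Or.inr (Or.inl ⟨c, c', d, d', rfl,
    hm.mono hrefl (le_max_left m n), hn.mono hrefl (le_max_right m n), rfl⟩)⟩

end Refinement

/-- Lemma 5: for an associative, partially ordered structure satisfying σ, the
canonical map θ of Definition 3 sends composition to relational composition. -/
theorem stmt7 {S : Type*} (le : S → S → Prop) (op : S → S → S)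
    (hrefl : ∀ a, le a a)
    (hantisymm : ∀ a b, le a b → le b a → a = b)
    (htrans : ∀ a b c, le a b → le b c → le a c)
    (hassoc : ∀ a b c, op (op a b) c = op a (op b c))
    (hσ : ∀ a b : S, Binf le op b a → Tinf le op b a b → le a b) :
    ∀ a b : S, theta le op (op a b) = rcomp (theta le op a) (theta le op b) := by
  intro a b
  ext ⟨x, y⟩
  constructor
  · rintro ⟨hini, hbeta, hδ, hlam⟩
    dsimp only at hini hbeta hδ hlam
    rw [hassoc] at hδ
    rcases y with p | y | y
    · exact absurd trivial hini
    · refine ⟨Sum.inr (Sum.inl (op b y)), ⟨id, hbeta, hδ, fun hx _ => ?_⟩,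
        ⟨id, id, Binf.refl hrefl _, fun _ _ => Tinf.refl hrefl _⟩⟩
      have h := hlam hx trivial
      rwa [hassoc] at h
    · exact ⟨Sum.inr (Sum.inr (op b y)),
        ⟨id, fun _ => trivial, hδ, fun _ h => h.elim⟩,
        ⟨id, id, Binf.refl hrefl _, fun _ h => h.elim⟩⟩
  · rintro ⟨z, ⟨hzini, hxz, hδxz, hlamxz⟩, ⟨hyini, hzy, hδzy, hlamzy⟩⟩
    refine ⟨hyini, fun hx => hzy (hxz hx), ?_, fun hx hy => ?_⟩
    · rw [hassoc]
      exact hδxz.trans hrefl (hδzy.op_left a)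
    · rcases z with p | z | z
      · exact absurd trivial hzini
      · rw [hassoc]
        have hδa := hδxz.trans hrefl (Binf.op_right hrefl a z)
        exact (hlamxz hx trivial).trans hrefl
          (Tinf.op_op hrefl ((Tinf.refl hrefl a).of_binf hrefl hδa) (hlamzy id hy))
      · rcases y with p | y | y
        · exact hy.elim
        · exact (hzy trivial).elim
        · exact hy.elim
end

section
/- (Finite representation property, Theorem 1.) Every finite (≤,∘)-structure S that has a (⊑,;)-representation has a (⊑,;)-representation over a finite base set X with |X| ≤ (1+|S|)² + 2·(1+|S|). -/
/-- Composition with an optional second factor, `none` acting as an identity. -/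
def rcompOpt {S X : Type*} (θ : S → Set (X × X)) (R : Set (X × X)) : Option S → Set (X × X)
  | none => R
  | some e => rcomp R (θ e)

/-- Nodes of the finite representation: a root for each pair of elements, and for each possible
future a node that remembers how it was reached (`true`) and one that does not (`false`). -/
abbrev FinNode (S : Type*) := (S × S) ⊕ (Bool × Option S)

/-- The element whose domain describes the possible future of a node. -/
def FinNode.future {S : Type*} : FinNode S → Option S
  | .inl p => some p.1
  | .inr q => q.2

/-- The element which every edge from the node to a remembering node has to contain. -/
def FinNode.bound {S : Type*} : FinNode S → Option S
  | .inl p => some p.2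
  | .inr (true, e) => e
  | .inr (false, _) => none

/-- The relations of the finite representation constructed from `θ`. -/
def finRel {S X : Type*} (θ : S → Set (X × X)) (c : S) : Set (FinNode S × FinNode S) :=
  {pq | ∃ b e, pq.2 = .inr (b, e) ∧ ∃ d, pq.1.future = some d ∧
    dom (θ d) ⊆ dom (rcompOpt θ (θ c) e) ∧
    (b = true → ∃ a, pq.1.bound = some a ∧
      ∀ r ∈ θ a, r.1 ∈ dom (θ d) → r ∈ rcompOpt θ (θ c) e)}

section

variable {S X : Type*} {θ : S → Set (X × X)}

theorem dom_rcompOpt_subset (R : Set (X × X)) (e : Option S) :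
    dom (rcompOpt θ R e) ⊆ dom R := by
  cases e with
  | none => exact subset_rfl
  | some e => rintro x ⟨y, z, hz, -⟩; exact ⟨z, hz⟩

theorem rcompOpt_rcomp (R T : Set (X × X)) (e : Option S) :
    rcompOpt θ (rcomp R T) e = rcomp R (rcompOpt θ T e) := by
  cases e with
  | none => rfl
  | some e =>
    ext ⟨x, y⟩
    constructor
    · rintro ⟨z, ⟨w, h₁, h₂⟩, h₃⟩
      exact ⟨w, h₁, z, h₂, h₃⟩
    · rintro ⟨w, h₁, z, h₂, h₃⟩
      exact ⟨z, ⟨w, h₁, h₂⟩, h₃⟩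

theorem mem_rcompOpt_of_refines {R T : Set (X × X)} (h : refines R T) {e : Option S}
    {p : X × X} (hp : p ∈ rcompOpt θ R e) (hd : p.1 ∈ dom T) : p ∈ rcompOpt θ T e := by
  cases e with
  | none => exact h.2 p hp hd
  | some e =>
    obtain ⟨z, h₁, h₂⟩ := hp
    exact ⟨z, h.2 (p.1, z) h₁ hd, h₂⟩

theorem dom_rcomp_mono (R : Set (X × X)) {T U : Set (X × X)} (h : dom T ⊆ dom U) :
    dom (rcomp R T) ⊆ dom (rcomp R U) := by
  rintro x ⟨y, z, h₁, h₂⟩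
  obtain ⟨w, hw⟩ := h ⟨y, h₂⟩
  exact ⟨w, z, h₁, hw⟩

theorem mem_dom_finRel {c : S} {p : FinNode S} :
    p ∈ dom (finRel θ c) ↔ ∃ d, p.future = some d ∧ dom (θ d) ⊆ dom (θ c) := by
  constructor
  · rintro ⟨q, b, e, -, d, hd, h, -⟩
    exact ⟨d, hd, h.trans (dom_rcompOpt_subset _ _)⟩
  · rintro ⟨d, hd, h⟩
    exact ⟨.inr (false, none), false, none, rfl, d, hd, h, nofun⟩

theorem refines_finRel {a b : S} (h : refines (θ a) (θ b)) :
    refines (finRel θ a) (finRel θ b) := by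
  constructor
  · intro p hp
    obtain ⟨d, hd, hdb⟩ := mem_dom_finRel.1 hp
    exact mem_dom_finRel.2 ⟨d, hd, hdb.trans h.1⟩
  · rintro ⟨p, q⟩ ⟨i, e, hq, d, hd, hda, hi⟩ hp
    obtain ⟨d', hd', hdb⟩ := mem_dom_finRel.1 hp
    obtain rfl : d = d' := Option.some.inj (hd.symm.trans hd')
    refine ⟨i, e, hq, d, hd, ?_, fun hb => ?_⟩
    · intro x hx
      obtain ⟨y, hy⟩ := hda hx
      exact ⟨y, mem_rcompOpt_of_refines h hy (hdb hx)⟩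
    · obtain ⟨c, hc, hca⟩ := hi hb
      exact ⟨c, hc, fun r hr hrd => mem_rcompOpt_of_refines h (hca r hr hrd) (hdb hrd)⟩

theorem refines_of_refines_finRel {a b : S} (h : refines (finRel θ a) (finRel θ b)) :
    refines (θ a) (θ b) := by
  have hdom : dom (θ b) ⊆ dom (θ a) := by
    obtain ⟨d, hd, hda⟩ := mem_dom_finRel.1
      (h.1 (mem_dom_finRel.2 ⟨b, rfl, subset_rfl⟩ :
        (.inr (false, some b) : FinNode S) ∈ dom (finRel θ b)))
    obtain rfl : b = d := Option.some.inj hd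
    exact hda
  refine ⟨hdom, ?_⟩
  have hmem := h.2 (.inl (b, a), .inr (true, none))
    ⟨true, none, rfl, b, rfl, hdom, fun _ => ⟨a, rfl, fun r hr _ => hr⟩⟩
    (mem_dom_finRel.2 ⟨b, rfl, subset_rfl⟩)
  obtain ⟨i, e, hq, d, hd, -, hi⟩ := hmem
  obtain ⟨rfl, rfl⟩ := Prod.mk.inj (Sum.inr.inj hq)
  obtain rfl : b = d := Option.some.inj hd
  obtain ⟨c, hc, hca⟩ := hi rfl
  obtain rfl : a = c := Option.some.inj hc
  exact hca

theorem finRel_op {op : S → S → S} (hop : ∀ a b, θ (op a b) = rcomp (θ a) (θ b)) (a b : S) :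
    finRel θ (op a b) = rcomp (finRel θ a) (finRel θ b) := by
  ext ⟨p, q⟩
  constructor
  · rintro ⟨i, e, hq, d, hd, hdab, hi⟩
    rw [hop, rcompOpt_rcomp] at hdab hi
    obtain ⟨f, hf⟩ : ∃ f, θ f = rcompOpt θ (θ b) e := by
      cases e with
      | none => exact ⟨b, rfl⟩
      | some e => exact ⟨op b e, hop b e⟩
    rw [← hf] at hdab hi
    exact ⟨.inr (i, some f), ⟨i, some f, rfl, d, hd, hdab, hi⟩, i, e, hq, f, rfl, hf ▸ subset_rfl,
      fun hb => ⟨f, by subst hb; rfl, fun r hr _ => hf ▸ hr⟩⟩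
  · rintro ⟨_, ⟨i, e, rfl, d, hd, hda, hi⟩, j, f, hq, g, hg, hgb, hj⟩
    obtain rfl : e = some g := hg
    refine ⟨j, f, hq, d, hd, ?_, fun hb => ?_⟩
    · rw [hop, rcompOpt_rcomp]
      exact hda.trans (dom_rcomp_mono _ hgb)
    · obtain ⟨k, hk, hkb⟩ := hj hb
      cases i with
      | false => exact absurd hk nofun
      | true =>
        obtain rfl : g = k := Option.some.inj hk
        obtain ⟨c, hc, hca⟩ := hi rfl
        refine ⟨c, hc, fun r hr hrd => ?_⟩
        rw [hop, rcompOpt_rcomp]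
        obtain ⟨z, h₁, h₂⟩ := hca r hr hrd
        exact ⟨z, h₁, hkb _ h₂ ⟨_, h₂⟩⟩

theorem IsRepresentation.finRel {le : S → S → Prop} {op : S → S → S}
    (h : IsRepresentation le op θ) : IsRepresentation le op (finRel θ) :=
  ⟨fun a b => (h.1 a b).trans ⟨refines_finRel, refines_of_refines_finRel⟩, finRel_op h.2⟩

end

/-- Finite representation property (Theorem 1): every finite representable
`(≤, ∘)`-structure has a representation over a finite base `X` with
`|X| ≤ (1 + |S|)² + 2·(1 + |S|)`. -/
theorem stmt9 (S : Type) [Fintype S] (le : S → S → Prop) (op : S → S → S)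
    (h : Representable S le op) :
    ∃ (X : Type) (θ : S → Set (X × X)), Finite X ∧ IsRepresentation le op θ ∧
      Nat.card X ≤ (1 + Fintype.card S) ^ 2 + 2 * (1 + Fintype.card S) := by
  obtain ⟨X, θ, hθ⟩ := h
  refine ⟨FinNode S, finRel θ, inferInstance, hθ.finRel, ?_⟩
  simp only [Nat.card_eq_fintype_card, Fintype.card_sum, Fintype.card_prod, Fintype.card_bool,
    Fintype.card_option]
  nlinarith
end

section
/- For every n and every k < n, the structure S_n satisfies σ_k: for all a,b ∈ S_n, if b ◄_k a and a ◁^b_k b then a ≤ b. -/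
/-- The underlying set of the structure `Sₙ`: elements `0`, `b`, `c`, and
`aᵢ`, `aᵢb`, `aᵢc` for `i < N` where `N = 1 + 2ⁿ` (indices in `ZMod N`,
i.e. addition of indices is modulo `N`). -/
inductive Elt (n : ℕ) : Type
  | zero : Elt n
  | b : Elt n
  | c : Elt n
  | a : ZMod (1 + 2 ^ n) → Elt n
  | ab : ZMod (1 + 2 ^ n) → Elt n
  | ac : ZMod (1 + 2 ^ n) → Elt n

/-- Composition in `Sₙ`: `aᵢ ∘ b = aᵢb`, `aᵢ ∘ c = aᵢc`, and all other
compositions are `0`. -/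
def eop {n : ℕ} : Elt n → Elt n → Elt n
  | Elt.a i, Elt.b => Elt.ab i
  | Elt.a i, Elt.c => Elt.ac i
  | _, _ => Elt.zero

/-- The ordering of `Sₙ`: the reflexive closure of
`{(s, 0) : s ∈ Sₙ} ∪ {(aᵢ₊₁b, aᵢ), (aᵢ, aᵢ₊₁c), (aᵢb, aᵢc) : i < N}`. -/
def ele {n : ℕ} (x y : Elt n) : Prop :=
  x = y ∨ y = Elt.zero ∨
  (∃ i, x = Elt.ab (i + 1) ∧ y = Elt.a i) ∨
  (∃ i, x = Elt.a i ∧ y = Elt.ac (i + 1)) ∨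
  (∃ i, x = Elt.ab i ∧ y = Elt.ac i)

/-- An upper bound for `◄ₖ` on `Sₙ`, where `m` (to be taken as `2 ^ k`) bounds the distance
by which an index may increase. -/
def Reach {n : ℕ} (m : ℕ) : Elt n → Elt n → Prop
  | Elt.zero, _ => True
  | Elt.b, Elt.b => True
  | Elt.c, Elt.c => True
  | Elt.a i, Elt.a j => ∃ t : ℕ, t ≤ m ∧ j = i + t
  | Elt.a i, Elt.ab j => ∃ t : ℕ, t < m ∧ j = i + 1 + t
  | Elt.ab i, Elt.a j => ∃ t : ℕ, t < m ∧ j = i + t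
  | Elt.ab i, Elt.ab j => ∃ t : ℕ, t < m ∧ j = i + t
  | Elt.ac i, Elt.a j => ∃ t : ℕ, t ≤ m ∧ j + 1 = i + t
  | Elt.ac i, Elt.ab j => ∃ t : ℕ, t < m ∧ j = i + t
  | Elt.ac i, Elt.ac j => i = j
  | _, _ => False

/-- An upper bound for `◁ˢₖ` on `Sₙ` when `s ≠ 0`. -/
def Step {n : ℕ} (m : ℕ) (s x y : Elt n) : Prop :=
  x = Elt.zero ∨
  (ele x y ∧ y ≠ Elt.zero ∧ (∀ j, y = Elt.ac j → x ≠ y → s = y) ∧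
    (∀ j, y = Elt.a j → x ≠ y → Reach m s y)) ∨
  (∃ i, s = Elt.ac (i + 1) ∧ (x = Elt.ab i ∨ x = Elt.ac i))

theorem ele_trans {n : ℕ} {x y z : Elt n} (h : ele x y) (h' : ele y z) : ele x z := by
  rcases h with rfl | rfl | ⟨i, rfl, rfl⟩ | ⟨i, rfl, rfl⟩ | ⟨i, rfl, rfl⟩ <;>
  rcases h' with h' | rfl | ⟨j, h', rfl⟩ | ⟨j, h', rfl⟩ | ⟨j, h', rfl⟩ <;>
  simp_all [ele]

theorem zmod_succ_ne_zero {n t : ℕ} (ht : t < 2 ^ n) : (1 + t : ZMod (1 + 2 ^ n)) ≠ 0 := by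
  intro h
  have h' : ((1 + t : ℕ) : ZMod (1 + 2 ^ n)) = 0 := by exact_mod_cast h
  rw [ZMod.natCast_eq_zero_iff] at h'
  have := Nat.le_of_dvd (by omega) h'
  omega

theorem zmod_add_one_ne {n : ℕ} (i : ZMod (1 + 2 ^ n)) : i + 1 ≠ i := by
  intro h
  have := zmod_succ_ne_zero (n := n) (t := 0) (by positivity)
  simp_all

theorem zmod_ne_wrap {n t : ℕ} (ht : t < 2 ^ n) (i : ZMod (1 + 2 ^ n)) : i ≠ i + 1 + t := by
  intro h
  apply zmod_succ_ne_zero ht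
  linear_combination -h

theorem Reach.refl {n m : ℕ} (hm : 0 < m) (x : Elt n) : Reach m x x := by
  cases x <;> simp only [Reach] <;> exact ⟨0, by omega, by simp⟩

theorem Reach.trans {n m : ℕ} {x y z : Elt n} (h : Reach m x y) (h' : Reach m y z) :
    Reach (m + m) x z := by
  rcases x with _ | _ | _ | i | i | i <;> rcases y with _ | _ | _ | j | j | j <;>
    simp only [Reach] at h <;>
    rcases z with _ | _ | _ | l | l | l <;> simp only [Reach] at h' ⊢
  case a.a.a | a.a.ab | ab.a.a | ab.ab.a | ab.ab.ab | ac.ab.ab =>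
    obtain ⟨t, ht, rfl⟩ := h
    obtain ⟨u, hu, rfl⟩ := h'
    exact ⟨t + u, by omega, by push_cast; ring⟩
  case a.ab.a | ab.a.ab | ac.ab.a =>
    obtain ⟨t, ht, rfl⟩ := h
    obtain ⟨u, hu, rfl⟩ := h'
    exact ⟨t + u + 1, by omega, by push_cast; ring⟩
  case a.ab.ab =>
    obtain ⟨t, ht, rfl⟩ := h
    obtain ⟨u, hu, rfl⟩ := h'
    exact ⟨t + u, by omega, by push_cast; ring⟩
  case ac.a.a | ac.a.ab =>
    obtain ⟨t, ht, h⟩ := h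
    obtain ⟨u, hu, rfl⟩ := h'
    exact ⟨t + u, by omega, by push_cast; linear_combination h⟩
  case ac.ac.a | ac.ac.ab =>
    obtain ⟨u, hu, h'⟩ := h'
    exact ⟨u, by omega, by rw [h, h']⟩
  case ac.ac.ac => exact h.trans h'

theorem Reach.double {n m : ℕ} (hm : 0 < m) {x y : Elt n} (h : Reach m x y) :
    Reach (m + m) x y :=
  h.trans (Reach.refl hm y)

theorem Reach.eq_zero {n m : ℕ} {x : Elt n} (h : Reach m x Elt.zero) : x = Elt.zero := by
  cases x <;> simp_all [Reach]

theorem Reach.eq_ac {n m : ℕ} {x : Elt n} {i : ZMod (1 + 2 ^ n)} (hx : x ≠ Elt.zero)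
    (h : Reach m x (Elt.ac i)) : x = Elt.ac i := by
  cases x <;> simp_all [Reach]

theorem eop_ne_zero {n : ℕ} {x y : Elt n} (h : eop x y ≠ Elt.zero) :
    ∃ i, x = Elt.a i ∧ (y = Elt.b ∨ y = Elt.c) := by
  cases x <;> cases y <;> simp_all [eop]

theorem ele.reach {n : ℕ} {x y : Elt n} (h : ele y x) : Reach 1 x y := by
  rcases h with rfl | rfl | ⟨i, rfl, rfl⟩ | ⟨i, rfl, rfl⟩ | ⟨i, rfl, rfl⟩
  · exact Reach.refl one_pos _
  · trivial
  all_goals exact ⟨0, by omega, by simp⟩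

theorem ele.reach_left {n : ℕ} {x y z : Elt n} (h : ele (eop y z) x) : Reach 1 x y := by
  by_cases h0 : eop y z = Elt.zero
  · rw [h0] at h
    have : x = Elt.zero := by
      rcases h with h | h | ⟨i, h, -⟩ | ⟨i, h, -⟩ | ⟨i, h, -⟩ <;> simp_all
    subst this
    trivial
  · obtain ⟨i, rfl, rfl | rfl⟩ := eop_ne_zero h0 <;> simp only [eop] at h <;>
      rcases h with rfl | rfl | ⟨j, h, rfl⟩ | ⟨j, h, rfl⟩ | ⟨j, h, rfl⟩ <;>
      simp only [reduceCtorEq, Elt.ab.injEq, Reach] at *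
    · exact ⟨0, by omega, by simp⟩
    · exact ⟨1, le_rfl, by simp [h]⟩
    · exact ⟨1, le_rfl, by simp [h]⟩
    · exact ⟨1, le_rfl, by simp⟩

theorem ele.step {n : ℕ} {x s : Elt n} (hs : s ≠ Elt.zero) (h : ele x s) : Step 1 s x s :=
  .inr (.inl ⟨h, hs, fun _ _ _ => rfl, fun _ _ _ => Reach.refl one_pos s⟩)

theorem Step.trans {n m : ℕ} (hm : 0 < m) {s x y z : Elt n} (h : Step m s x y)
    (h' : Step m s y z) : Step (m + m) s x z := by
  rcases h with h | ⟨h1, h2, h3, h4⟩ | h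
  · exact .inl h
  · rcases h' with h' | ⟨k1, k2, k3, k4⟩ | ⟨i, rfl, h'⟩
    · exact absurd h' h2
    · refine .inr (.inl ⟨ele_trans h1 k1, k2, fun j hz hxz => ?_, fun j hz hxz => ?_⟩)
      · by_cases hyz : y = z
        · subst hyz; exact h3 j hz hxz
        · exact k3 j hz hyz
      · by_cases hyz : y = z
        · subst hyz; exact (h4 j hz hxz).double hm
        · exact (k4 j hz hyz).double hm
    · refine .inr (.inr ⟨i, rfl, ?_⟩)
      by_cases hxy : x = y
      · rwa [hxy]
      · rcases h' with rfl | rfl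
        · rcases h1 with h1 | h1 | ⟨j, -, h1⟩ | ⟨j, -, h1⟩ | ⟨j, -, h1⟩ <;> simp_all
        · have := h3 i rfl hxy
          exact absurd (Elt.ac.inj this) (zmod_add_one_ne i)
  · exact .inr (.inr h)

theorem Step.eq_of_b_or_c {n m : ℕ} {d d' : Elt n} (hd : d = Elt.b ∨ d = Elt.c)
    (h : Step m d d d') : d' = d := by
  rcases hd with rfl | rfl <;>
  · rcases h with h | ⟨h, h2, -, -⟩ | ⟨i, h, -⟩
    · simp at h
    · rcases h with h | h | ⟨j, h, -⟩ | ⟨j, h, -⟩ | ⟨j, h, -⟩ <;> simp_all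
    · simp at h

theorem Step.eop {n m M : ℕ} {s x x' d d' : Elt n} (h : Step m s x x')
    (hd : d ≠ Elt.zero → Step m d d d') : Step M s (eop x d) (eop x' d') := by
  by_cases h0 : _root_.eop x d = Elt.zero
  · exact .inl h0
  obtain ⟨i, rfl, hbc⟩ := eop_ne_zero h0
  obtain rfl := (hd (by rcases hbc with rfl | rfl <;> simp)).eq_of_b_or_c hbc
  rcases h with h | ⟨h1, h2, h3, -⟩ | ⟨j, -, h⟩
  · simp at h
  · rcases h1 with rfl | h1 | ⟨j, h1, -⟩ | ⟨j, h1, rfl⟩ | ⟨j, h1, -⟩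
    · exact .inr (.inl ⟨.inl rfl, h0, fun _ _ h => absurd rfl h, fun _ _ h => absurd rfl h⟩)
    · exact absurd h1 h2
    · simp at h1
    · obtain rfl := Elt.a.inj h1
      refine .inr (.inr ⟨i, h3 _ rfl (by simp), ?_⟩)
      rcases hbc with rfl | rfl <;> simp [_root_.eop]
    · simp at h1
  · simp at h

theorem Step.of_reach {n m : ℕ} {s s' x y : Elt n} (hs : s ≠ Elt.zero) (h : Step m s' x y)
    (hss : Reach m s s') : Step (m + m) s x y := by
  rcases h with h | ⟨h1, h2, h3, h4⟩ | ⟨i, rfl, h⟩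
  · exact .inl h
  · refine .inr (.inl ⟨h1, h2, fun j hy hxy => ?_, fun j hy hxy => hss.trans (h4 j hy hxy)⟩)
    have := h3 j hy hxy
    subst this hy
    exact hss.eq_ac hs
  · exact .inr (.inr ⟨i, hss.eq_ac hs, h⟩)

theorem Step.reach {n m : ℕ} (hm : 0 < m) {x y : Elt n}
    (h : Step m x x y) : Reach m x y := by
  rcases h with rfl | ⟨h1, h2, h3, h4⟩ | ⟨i, rfl, h⟩
  · trivial
  · by_cases hxy : x = y
    · subst hxy; exact Reach.refl hm x
    rcases h1 with h1 | h1 | ⟨i, rfl, rfl⟩ | ⟨i, rfl, rfl⟩ | ⟨i, rfl, rfl⟩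
    · exact absurd h1 hxy
    · exact absurd h1 h2
    · exact h4 i rfl hxy
    · exact absurd (h3 _ rfl hxy) hxy
    · exact absurd (h3 _ rfl hxy) hxy
  · rcases h with h | h
    · simp at h
    · exact absurd (Elt.ac.inj h) (zmod_add_one_ne i)

theorem BT_bounds (n k : ℕ) :
    (∀ x y : Elt n, (BT ele eop k).1 x y → Reach (2 ^ k) x y) ∧
    (∀ s x y : Elt n, s ≠ Elt.zero → (BT ele eop k).2 s x y → Step (2 ^ k) s x y) := by
  induction k with
  | zero =>
    refine ⟨fun x y h => ?_, fun s x y hs h => ?_⟩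
    · rcases h with h | ⟨z, h⟩
      · exact h.reach
      · exact h.reach_left
    · obtain ⟨h, rfl⟩ := h
      exact h.step hs
  | succ k ih =>
    obtain ⟨ihB, ihT⟩ := ih
    have hm : 0 < 2 ^ k := by positivity
    rw [pow_succ, mul_two]
    refine ⟨fun x y h => ?_, fun s x y hs h => ?_⟩
    · rcases h with h | ⟨z, h, h'⟩ | ⟨d, f, f', rfl, h, rfl⟩
      · by_cases hx : x = Elt.zero
        · subst hx; trivial
        · exact ((ihT x x y hx h).reach hm).double hm
      · exact (ihB _ _ h).trans (ihB _ _ h')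
      · by_cases h0 : eop d f = Elt.zero
        · rw [h0]; trivial
        · obtain ⟨i, rfl, hf⟩ := eop_ne_zero h0
          have : f' = f := by
            have := ihB _ _ h
            rcases hf with rfl | rfl <;> cases f' <;> simp_all [Reach]
          subst this
          exact Reach.refl (by omega) _
    · rcases h with ⟨z, h, h'⟩ | ⟨u, u', d, d', rfl, h, h', rfl⟩ | ⟨s', h, h'⟩
      · exact (ihT _ _ _ hs h).trans hm (ihT _ _ _ hs h')
      · exact (ihT _ _ _ hs h).eop fun hd => ihT _ _ _ hd h'
      · have hr := ihB _ _ h'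
        have hs' : s' ≠ Elt.zero := by
          rintro rfl
          exact hs hr.eq_zero
        exact (ihT _ _ _ hs' h).of_reach hs hr

/-- For every `n` and `k < n`, the structure `Sₙ` satisfies `σₖ`. -/
theorem stmt10 (n k : ℕ) (hk : k < n) :
    ∀ x y : Elt n, Bn ele eop k y x → Tn ele eop k y x y → ele x y := by
  intro x y hB hT
  obtain ⟨ihB, ihT⟩ := BT_bounds n k
  have hmn : 2 ^ k ≤ 2 ^ n := Nat.pow_le_pow_right (by norm_num) hk.le
  by_cases hy : y = Elt.zero
  · exact .inr (.inl hy)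
  have hr := ihB _ _ hB
  rcases ihT _ _ _ hy hT with rfl | h | ⟨i, rfl, rfl | rfl⟩
  · exact absurd hr.eq_zero hy
  · exact h.1
  · obtain ⟨t, ht, h⟩ := hr
    exact absurd h (zmod_ne_wrap (by omega) i)
  · exact absurd hr (zmod_add_one_ne i)
end

section
/- For every n ≥ 2, the structure S_n has no (⊑,;)-representation: there is no set X and map θ from S_n to binary relations on X such that for all a,b ∈ S_n, a ≤ b iff θ(a) ⊑ θ(b) and θ(a∘b) = θ(a);θ(b). -/
/-- In a representation of `Sₙ`, all the `aᵢ` have the same domain. -/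
theorem IsRepresentation.dom_a_subset {n : ℕ} {X : Type*} {θ : Elt n → Set (X × X)}
    (h : IsRepresentation ele eop θ) (i j : ZMod (1 + 2 ^ n)) :
    dom (θ (.a i)) ⊆ dom (θ (.a j)) := by
  have step (i) : dom (θ (.a i)) ⊆ dom (θ (.a (i + 1))) := by
    intro x hx
    have hle : ele (n := n) (.ab (i + 1)) (.a i) := Or.inr (.inr (.inl ⟨i, rfl, rfl⟩))
    obtain ⟨y, hy⟩ := ((h.1 _ _).1 hle).1 hx
    rw [show Elt.ab (i + 1) = eop (.a (i + 1)) .b from rfl, h.2] at hy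
    obtain ⟨z, hz, -⟩ := hy
    exact ⟨z, hz⟩
  have steps (k : ℕ) : dom (θ (.a i)) ⊆ dom (θ (.a (i + k))) := by
    induction k with
    | zero => simp
    | succ k ih => simpa [add_assoc] using ih.trans (step (i + k))
  have : NeZero (1 + 2 ^ n) := ⟨by positivity⟩
  simpa using steps (j - i).val

/-- The relation `a₀ ≤ a₀c`, which fails in `Sₙ`, holds in every representation of it. -/
theorem IsRepresentation.refines_a_ac {n : ℕ} {X : Type*} {θ : Elt n → Set (X × X)}
    (h : IsRepresentation ele eop θ) : refines (θ (.a 0)) (θ (.ac 0)) := by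
  have hab_a (i) : refines (θ (.ab (i + 1))) (θ (.a i)) :=
    (h.1 _ _).1 (Or.inr (.inr (.inl ⟨i, rfl, rfl⟩)))
  have ha_ac (i) : refines (θ (.a i)) (θ (.ac (i + 1))) :=
    (h.1 _ _).1 (Or.inr (.inr (.inr (.inl ⟨i, rfl, rfl⟩))))
  have ha_zero (i) : refines (θ (.a i)) (θ .zero) := (h.1 _ _).1 (Or.inr (.inl rfl))
  have hab (i) : θ (.ab i) = rcomp (θ (.a i)) (θ .b) := h.2 (.a i) .b
  have hacb (i) : θ .zero = rcomp (θ (.ac i)) (θ .b) := h.2 (.ac i) .b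
  have habb (i) : θ .zero = rcomp (θ (.ab i)) (θ .b) := h.2 (.ab i) .b
  have hsub : dom (θ (.ac 0)) ⊆ dom (θ (.a (-1))) := by simpa using (ha_ac (-1)).1
  refine ⟨hsub.trans (h.dom_a_subset _ _), ?_⟩
  rintro ⟨x, y⟩ hxy hx
  have hD (i) : x ∈ dom (θ (.a i)) := h.dom_a_subset (-1) i (hsub hx)
  have key (p) (hp : p ∈ θ (.a (-1))) (hp1 : p.1 = x) : p ∈ θ (.ac 0) := by
    have := (ha_ac (-1)).2 p hp
    rw [neg_add_cancel, hp1] at this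
    exact this hx
  have hZ : x ∈ dom (θ .zero) := by
    obtain ⟨v, hv⟩ := (hab_a (-1 - 1)).1 (hD _)
    rw [sub_add_cancel, hab] at hv
    obtain ⟨u, hu, huv⟩ := hv
    refine ⟨v, ?_⟩
    rw [hacb 0]
    exact ⟨u, key _ hu rfl, huv⟩
  have hy : (x, y) ∈ θ .zero := (ha_zero 0).2 _ hxy hZ
  rw [habb (0 + 1)] at hy
  obtain ⟨w, hw, hwy⟩ := hy
  have hab0 : (x, y) ∈ θ (.ab (-1 + 1)) := by
    rw [neg_add_cancel, hab]
    exact ⟨w, (hab_a 0).2 _ hw (hD 0), hwy⟩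
  exact key _ ((hab_a (-1)).2 _ hab0 (hD _)) rfl

/-- For `n ≥ 2`, the structure `Sₙ` has no `(⊑, ;)`-representation. -/
theorem stmt11 (n : ℕ) (hn : 2 ≤ n) : ¬ Representable (Elt n) ele eop := by
  rintro ⟨X, θ, h⟩
  have : Fact (1 < 1 + 2 ^ n) := ⟨by simp⟩
  have hle : ele (n := n) (.a 0) (.ac 0) := (h.1 _ _).2 h.refines_a_ac
  rcases hle with h | h | ⟨i, h, -⟩ | ⟨i, h, hi⟩ | ⟨i, h, -⟩ <;> cases h
  simp at hi
end

section
/- (Theorem 2.) The class R(⊑,;) is not finitely axiomatisable: there is no first-order sentence φ in the language with one binary relation symbol ≤ and one binary function symbol ∘ such that for every (≤,∘)-structure S, S satisfies φ if and only if S has a (⊑,;)-representation. (Equivalently, no finite set of first-order (≤,∘)-formulas defines R(⊑,;).) -/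
open FirstOrder

/-- Symbol type: exactly one symbol of arity 2, no symbols of other arities. -/
def BinSym : ℕ → Type
  | 2 => Unit
  | _ => Empty

/-- The first-order language with one binary function symbol `∘` and one binary
relation symbol `≤`. -/
def L : FirstOrder.Language := ⟨BinSym, BinSym⟩

/-- The interpretation of the relation symbol `≤` in an `L`-structure. -/
def leOf (M : Type) (str : L.Structure M) (x y : M) : Prop :=
  str.RelMap (n := 2) (() : L.Relations 2) ![x, y]

/-- The interpretation of the function symbol `∘` in an `L`-structure. -/
def opOf (M : Type) (str : L.Structure M) (x y : M) : M :=
  str.funMap (n := 2) (() : L.Functions 2) ![x, y]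

section UltraRelation

open Filter

/-- The ultraproduct of a family of relations, on the full function space. -/
def ultraRel {ι X : Type*} (W : Ultrafilter ι) (R : ι → Set (X × X)) :
    Set ((ι → X) × (ι → X)) :=
  {p | ∀ᶠ i in W, (p.1 i, p.2 i) ∈ R i}

variable {ι X : Type*} {W : Ultrafilter ι} {R S : ι → Set (X × X)}

theorem ultraRel_congr (h : ∀ᶠ i in W, R i = S i) : ultraRel W R = ultraRel W S := by
  ext p
  exact eventually_congr (h.mono fun i hi => by rw [hi])

theorem mem_dom_ultraRel {x : ι → X} :
    x ∈ dom (ultraRel W R) ↔ ∀ᶠ i in W, x i ∈ dom (R i) := by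
  constructor
  · rintro ⟨y, hy⟩
    exact hy.mono fun i hi => ⟨y i, hi⟩
  · intro h
    have : ∀ i, ∃ y, x i ∈ dom (R i) → (x i, y) ∈ R i := fun i => by
      by_cases hi : x i ∈ dom (R i)
      · obtain ⟨y, hy⟩ := hi
        exact ⟨y, fun _ => hy⟩
      · exact ⟨x i, fun h' => absurd h' hi⟩
    choose y hy using this
    exact ⟨y, h.mono fun i hi => hy i hi⟩

theorem ultraRel_rcomp :
    ultraRel W (fun i => rcomp (R i) (S i)) = rcomp (ultraRel W R) (ultraRel W S) := by
  ext ⟨x, y⟩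
  constructor
  · intro h
    have : ∀ i, ∃ z, (x i, y i) ∈ rcomp (R i) (S i) → (x i, z) ∈ R i ∧ (z, y i) ∈ S i := fun i => by
      by_cases hi : (x i, y i) ∈ rcomp (R i) (S i)
      · obtain ⟨z, hz⟩ := hi
        exact ⟨z, fun _ => hz⟩
      · exact ⟨x i, fun h' => absurd h' hi⟩
    choose z hz using this
    exact ⟨z, h.mono fun i hi => (hz i hi).1, h.mono fun i hi => (hz i hi).2⟩
  · rintro ⟨z, hz, hz'⟩
    exact hz.mp (hz'.mono fun i h' h => ⟨z i, h, h'⟩)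

theorem refines_ultraRel [Nonempty X] :
    refines (ultraRel W R) (ultraRel W S) ↔ ∀ᶠ i in W, refines (R i) (S i) := by
  constructor
  · intro h
    by_contra hc
    rw [← Ultrafilter.eventually_not] at hc
    have : ∀ i, ∃ x y, ¬ refines (R i) (S i) →
        x ∈ dom (S i) ∧ (x ∈ dom (R i) → (x, y) ∈ R i ∧ (x, y) ∉ S i) := fun i => by
      by_cases hi : refines (R i) (S i)
      · exact ⟨Classical.arbitrary X, Classical.arbitrary X, fun h' => absurd hi h'⟩
      · by_cases hd : dom (S i) ⊆ dom (R i)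
        · have : ∃ p ∈ R i, p.1 ∈ dom (S i) ∧ p ∉ S i := by
            by_contra! hp
            exact hi ⟨hd, hp⟩
          obtain ⟨⟨x, y⟩, h1, h2, h3⟩ := this
          exact ⟨x, y, fun _ => ⟨h2, fun _ => ⟨h1, h3⟩⟩⟩
        · obtain ⟨x, h1, h2⟩ := Set.not_subset.1 hd
          exact ⟨x, x, fun _ => ⟨h1, fun h' => absurd h' h2⟩⟩
    choose x y hxy using this
    have hS : x ∈ dom (ultraRel W S) := mem_dom_ultraRel.2 (hc.mono fun i hi => (hxy i hi).1)
    have hR := mem_dom_ultraRel.1 (h.1 hS)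
    have hmem : (x, y) ∈ ultraRel W R :=
      hc.mp (hR.mono fun i hi hi' => ((hxy i hi').2 hi).1)
    have hnot : ∀ᶠ i in W, (x i, y i) ∉ S i :=
      hc.mp (hR.mono fun i hi hi' => ((hxy i hi').2 hi).2)
    exact Ultrafilter.eventually_not.1 hnot (h.2 _ hmem hS)
  · intro h
    refine ⟨fun x hx => ?_, fun p hp hx => ?_⟩
    · exact mem_dom_ultraRel.2 (h.mp ((mem_dom_ultraRel.1 hx).mono fun i hi h' => h'.1 hi))
    · filter_upwards [h, hp, mem_dom_ultraRel.1 hx] with i h1 h2 h3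
      exact h1.2 _ h2 h3

end UltraRelation

/-- The carrier of the structures witnessing non-finite axiomatisability. -/
inductive Elt_s12 : Type
  | zero : Elt_s12
  | g : Elt_s12
  | b (i : ℕ) : Elt_s12
  | e (i : ℕ) : Elt_s12

namespace Elt_s12

/-- Composition: `b i ∘ g = e i`, all other products are `zero`. -/
def op : Elt_s12 → Elt_s12 → Elt_s12
  | b i, g => e i
  | _, _ => zero

/-- The order with top `zero` generated by `e i ≤ b (i + 1)` for `i < n` and `b 0 ≤ b n`. -/
def le (n : ℕ) (s t : Elt_s12) : Prop :=
  s = t ∨ t = zero ∨ (∃ i < n, s = e i ∧ t = b (i + 1)) ∨ (s = b 0 ∧ t = b n)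

theorem not_representable {n : ℕ} (hn : 0 < n) : ¬ Representable Elt_s12 (le n) op := by
  rintro ⟨X, θ, hle, hop⟩
  have hbe : ∀ i, dom (θ (e i)) ⊆ dom (θ (b i)) := by
    rintro i x ⟨y, hy⟩
    rw [show e i = op (b i) g from rfl, hop] at hy
    obtain ⟨z, hz, -⟩ := hy
    exact ⟨z, hz⟩
  have hedge : ∀ i < n, dom (θ (b (i + 1))) ⊆ dom (θ (e i)) := fun i hi =>
    ((hle _ _).1 (Or.inr (Or.inr (Or.inl ⟨i, hi, rfl, rfl⟩)))).1
  have hchain : ∀ i ≤ n, dom (θ (e i)) ⊆ dom (θ (e 0)) := by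
    intro i
    induction i with
    | zero => exact fun _ => subset_rfl
    | succ k ih => exact fun hk => ((hbe _).trans (hedge k hk)).trans (ih (by omega))
  have hb := (hle (b 0) (b n)).1 (Or.inr (Or.inr (Or.inr ⟨rfl, rfl⟩)))
  have key : le n (e 0) (e n) := by
    refine (hle _ _).2 ⟨hchain n le_rfl, ?_⟩
    rintro ⟨x, y⟩ hxy hx
    rw [show e 0 = op (b 0) g from rfl, hop] at hxy
    rw [show e n = op (b n) g from rfl, hop]
    obtain ⟨z, hz, hz'⟩ := hxy
    exact ⟨z, hb.2 _ hz (hbe n hx), hz'⟩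
  rcases key with h | h | ⟨i, -, -, h⟩ | ⟨h, -⟩
  · injection h with h
    omega
  all_goals cases h

/-- The points that a source can be related to. -/
inductive Tgt : Type
  | zp | zq | p | q | r

open Tgt

/-- The relation on targets interpreting `g`. -/
def gRel (v w : Tgt) : Prop := (v = zp ∧ w = p) ∨ (v = zq ∧ w = q)

/-- A source `β` sends `b i` to the targets in `β i`; it is admissible when it respects every
generating inequality except `e j ≤ b (j + 1)`. -/
def Admissible (n j : ℕ) (β : ℕ → Set Tgt) : Prop :=
  (∀ m < n, m ≠ j → (β (m + 1)).Nonempty →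
    (∃ v ∈ β m, ∃ w, gRel v w) ∧ ∀ v ∈ β m, ∀ w, gRel v w → w ∈ β (m + 1)) ∧
  ((β n).Nonempty → (β 0).Nonempty ∧ β 0 ⊆ β n)

/-- The base set: sources and targets. -/
abbrev Pt : Type := (ℕ → Set Tgt) ⊕ Tgt

/-- Interpretation of the elements as relations, ignoring the inequality `e j ≤ b (j + 1)`. -/
def rel (n j : ℕ) : Elt_s12 → Set (Pt × Pt)
  | zero => ∅
  | g => {x | ∃ v w, gRel v w ∧ x = (Sum.inr v, Sum.inr w)}
  | b i => {x | ∃ β v, Admissible n j β ∧ v ∈ β i ∧ x = (Sum.inl β, Sum.inr v)}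
  | e i => {x | ∃ β v w, Admissible n j β ∧ v ∈ β i ∧ gRel v w ∧ x = (Sum.inl β, Sum.inr w)}

variable {n j : ℕ}

@[simp] theorem mem_rel_zero (x : Pt × Pt) : x ∉ rel n j zero := id

@[simp] theorem mem_rel_g {x y : Pt} :
    (x, y) ∈ rel n j g ↔ ∃ v w, gRel v w ∧ x = Sum.inr v ∧ y = Sum.inr w := by
  simp [rel]

@[simp] theorem mem_rel_b {i : ℕ} {x y : Pt} :
    (x, y) ∈ rel n j (b i) ↔
      ∃ β v, Admissible n j β ∧ v ∈ β i ∧ x = Sum.inl β ∧ y = Sum.inr v := by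
  simp [rel]

@[simp] theorem mem_rel_e {i : ℕ} {x y : Pt} :
    (x, y) ∈ rel n j (e i) ↔
      ∃ β v w, Admissible n j β ∧ v ∈ β i ∧ gRel v w ∧ x = Sum.inl β ∧ y = Sum.inr w := by
  simp [rel]

theorem rel_op (s t : Elt_s12) : rel n j (op s t) = rcomp (rel n j s) (rel n j t) := by
  ext ⟨x, y⟩
  cases s <;> cases t <;> simp only [op, rcomp, Set.mem_ofPred_eq] <;>
    simp only [mem_rel_zero, mem_rel_g, mem_rel_b, mem_rel_e]
  case b.g i =>
    constructor
    · rintro ⟨β, v, w, h1, h2, h3, rfl, rfl⟩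
      exact ⟨_, ⟨β, v, h1, h2, rfl, rfl⟩, v, w, h3, rfl, rfl⟩
    · rintro ⟨_, ⟨β, v, h1, h2, rfl, rfl⟩, v', w, h3, h, rfl⟩
      cases h
      exact ⟨β, v, w, h1, h2, h3, rfl, rfl⟩
  case g.g =>
    refine ⟨False.elim, ?_⟩
    rintro ⟨_, ⟨v, w, h, rfl, rfl⟩, v', w', h', h2, rfl⟩
    cases h2
    rcases h with ⟨rfl, rfl⟩ | ⟨rfl, rfl⟩ <;> rcases h' with ⟨h, -⟩ | ⟨h, -⟩ <;> cases h
  case e.g =>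
    refine ⟨False.elim, ?_⟩
    rintro ⟨_, ⟨β, v, w, -, -, h, rfl, rfl⟩, v', w', h', h2, rfl⟩
    cases h2
    rcases h with ⟨rfl, rfl⟩ | ⟨rfl, rfl⟩ <;> rcases h' with ⟨h, -⟩ | ⟨h, -⟩ <;> cases h
  all_goals
    refine ⟨False.elim, ?_⟩
    aesop

theorem mem_dom_rel_b {i : ℕ} {β : ℕ → Set Tgt} :
    Sum.inl β ∈ dom (rel n j (b i)) ↔ Admissible n j β ∧ (β i).Nonempty := by
  constructor
  · rintro ⟨y, hy⟩
    obtain ⟨β', v, h, hv, hx, rfl⟩ := mem_rel_b.1 hy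
    cases hx
    exact ⟨h, v, hv⟩
  · rintro ⟨h, v, hv⟩
    exact ⟨_, mem_rel_b.2 ⟨β, v, h, hv, rfl, rfl⟩⟩

theorem mem_dom_rel_e {i : ℕ} {β : ℕ → Set Tgt} :
    Sum.inl β ∈ dom (rel n j (e i)) ↔ Admissible n j β ∧ ∃ v ∈ β i, ∃ w, gRel v w := by
  constructor
  · rintro ⟨y, hy⟩
    obtain ⟨β', v, w, h, hv, hw, hx, rfl⟩ := mem_rel_e.1 hy
    cases hx
    exact ⟨h, v, hv, w, hw⟩
  · rintro ⟨h, v, hv, w, hw⟩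
    exact ⟨_, mem_rel_e.2 ⟨β, v, w, h, hv, hw, rfl, rfl⟩⟩

theorem refines_rel {s t : Elt_s12} (h : le n s t) (hj : ¬ (s = e j ∧ t = b (j + 1))) :
    refines (rel n j s) (rel n j t) := by
  rcases h with rfl | rfl | ⟨i, hi, rfl, rfl⟩ | ⟨rfl, rfl⟩
  · exact ⟨subset_rfl, fun p hp _ => hp⟩
  · exact ⟨fun x ⟨y, hy⟩ => hy.elim, fun p _ ⟨y, hy⟩ => hy.elim⟩
  · have hij : i ≠ j := by
      rintro rfl
      exact hj ⟨rfl, rfl⟩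
    constructor
    · rintro x ⟨y, hy⟩
      obtain ⟨β, v, h, hv, rfl, rfl⟩ := mem_rel_b.1 hy
      exact mem_dom_rel_e.2 ⟨h, (h.1 i hi hij ⟨v, hv⟩).1⟩
    · rintro ⟨x, y⟩ hxy hx
      obtain ⟨β, v, w, h, hv, hw, rfl, rfl⟩ := mem_rel_e.1 hxy
      exact mem_rel_b.2
        ⟨β, w, h, (h.1 i hi hij (mem_dom_rel_b.1 hx).2).2 v hv w hw, rfl, rfl⟩
  · constructor
    · rintro x ⟨y, hy⟩
      obtain ⟨β, v, h, hv, rfl, rfl⟩ := mem_rel_b.1 hy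
      exact mem_dom_rel_b.2 ⟨h, (h.2 ⟨v, hv⟩).1⟩
    · rintro ⟨x, y⟩ hxy hx
      obtain ⟨β, v, h, hv, rfl, rfl⟩ := mem_rel_b.1 hxy
      exact mem_rel_b.2 ⟨β, v, h, (h.2 (mem_dom_rel_b.1 hx).2).2 hv, rfl, rfl⟩

theorem admissible_univ : Admissible n j fun _ => Set.univ :=
  ⟨fun _ _ _ _ => ⟨⟨zq, trivial, q, Or.inr ⟨rfl, rfl⟩⟩, fun _ _ _ _ => trivial⟩,
    fun h => ⟨h, subset_rfl⟩⟩

/-- The source relating `b m` to `zp`, `p`, `r` exactly when `A m`, `B m`, `C m` hold. -/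
def source (A B C : ℕ → Prop) (m : ℕ) : Set Tgt :=
  {v | (v = zp → A m) ∧ (v = p → B m) ∧ (v = r → C m)}

theorem admissible_source {A B C : ℕ → Prop} (hAB : ∀ m < n, A m → B (m + 1))
    (hA : A 0 → A n) (hB : B 0 → B n) (hC : C 0 → C n) : Admissible n j (source A B C) := by
  refine ⟨fun m hm _ _ => ⟨⟨zq, by simp [source], q, Or.inr ⟨rfl, rfl⟩⟩, ?_⟩,
    fun _ => ⟨⟨zq, by simp [source]⟩, ?_⟩⟩
  · rintro v hv w (⟨rfl, rfl⟩ | ⟨rfl, rfl⟩)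
    · simpa [source] using hAB m hm (hv.1 rfl)
    · simp [source]
  · rintro v ⟨h1, h2, h3⟩
    exact ⟨fun h => hA (h1 h), fun h => hB (h2 h), fun h => hC (h3 h)⟩

theorem le_of_refines_b_b {i k : ℕ} (h : refines (rel n j (b i)) (rel n j (b k))) :
    le n (b i) (b k) := by
  by_contra hle
  have hik : i ≠ k := by
    rintro rfl
    exact hle (Or.inl rfl)
  have hik' : ¬ (i = 0 ∧ k = n) := by
    rintro ⟨rfl, rfl⟩
    exact hle (Or.inr (Or.inr (Or.inr ⟨rfl, rfl⟩)))
  set C : ℕ → Prop := fun m => m = i ∨ (i = 0 ∧ m = n) with hC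
  have hadm : Admissible n j (source (fun _ => True) (fun _ => True) C) :=
    admissible_source (by simp) (by simp) (by simp) (by simp only [hC]; grind)
  have := h.2 (Sum.inl (source (fun _ => True) (fun _ => True) C), Sum.inr r)
    (mem_rel_b.2 ⟨_, r, hadm, by simp [source, hC], rfl, rfl⟩)
    (mem_dom_rel_b.2 ⟨hadm, zq, by simp [source]⟩)
  obtain ⟨β, v, -, hv, h1, h2⟩ := mem_rel_b.1 this
  cases h1
  cases h2
  have := hv.2.2 rfl
  simp only [hC] at this
  omega

theorem le_of_refines_e_b {i k : ℕ} (h : refines (rel n j (e i)) (rel n j (b k))) :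
    le n (e i) (b k) := by
  by_contra hle
  have hik : ¬ (i < n ∧ k = i + 1) := by
    rintro ⟨hi, rfl⟩
    exact hle (Or.inr (Or.inr (Or.inl ⟨i, hi, rfl, rfl⟩)))
  set A : ℕ → Prop := fun m => m = i ∨ (i = 0 ∧ m = n) with hA
  set B : ℕ → Prop := fun m => m ≠ k ∧ ¬ (m = 0 ∧ k = n) with hB
  have hadm : Admissible n j (source A B fun _ => True) :=
    admissible_source (by simp only [hA, hB]; grind) (by simp only [hA]; grind)
      (by simp only [hB]; grind) (by simp)
  have := h.2 (Sum.inl (source A B fun _ => True), Sum.inr p)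
    (mem_rel_e.2 ⟨_, zp, p, hadm, by simp [source, hA], Or.inl ⟨rfl, rfl⟩, rfl, rfl⟩)
    (mem_dom_rel_b.2 ⟨hadm, zq, by simp [source]⟩)
  obtain ⟨β, v, -, hv, h1, h2⟩ := mem_rel_b.1 this
  cases h1
  cases h2
  exact (hv.2.1 rfl).1 rfl

theorem le_of_refines_e_e (hjn : j < n) {i k : ℕ}
    (h : refines (rel n j (e i)) (rel n j (e k))) : le n (e i) (e k) := by
  by_contra hle
  have hik : i ≠ k := by
    rintro rfl
    exact hle (Or.inl rfl)
  by_cases hik' : i = 0 ∧ k = n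
  · obtain ⟨rfl, rfl⟩ := hik'
    set β : ℕ → Set Tgt := fun m => {v | j < m ∨ (m = 0 ∧ v = r)} with hβ
    have hadm : Admissible k j β := by
      refine ⟨fun m _ hmj ⟨v, hv⟩ => ?_,
        fun _ => ⟨⟨r, Or.inr ⟨rfl, rfl⟩⟩, fun v _ => Or.inl hjn⟩⟩
      have hv' : j < m + 1 ∨ (m + 1 = 0 ∧ v = r) := hv
      have hm : j < m := by omega
      exact ⟨⟨zq, Or.inl hm, q, Or.inr ⟨rfl, rfl⟩⟩, fun _ _ _ _ => Or.inl (by omega)⟩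
    have := h.1 (mem_dom_rel_e.2 ⟨hadm, zq, Or.inl hjn, q, Or.inr ⟨rfl, rfl⟩⟩)
    obtain ⟨-, v, hv, w, hw⟩ := mem_dom_rel_e.1 this
    rcases hv with hv | ⟨-, rfl⟩
    · omega
    · rcases hw with ⟨h, -⟩ | ⟨h, -⟩ <;> cases h
  · set A : ℕ → Prop := fun m => m = i ∨ (i = 0 ∧ m = n) with hA
    have hadm : Admissible n j (source A (fun _ => True) fun _ => True) :=
      admissible_source (by simp) (by simp only [hA]; grind) (by simp) (by simp)
    have := h.2 (Sum.inl (source A (fun _ => True) fun _ => True), Sum.inr p)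
      (mem_rel_e.2 ⟨_, zp, p, hadm, by simp [source, hA], Or.inl ⟨rfl, rfl⟩, rfl, rfl⟩)
      (mem_dom_rel_e.2 ⟨hadm, zq, by simp [source], q, Or.inr ⟨rfl, rfl⟩⟩)
    obtain ⟨β, v, w, -, hv, hw, h1, h2⟩ := mem_rel_e.1 this
    cases h1
    cases h2
    rcases hw with ⟨rfl, -⟩ | ⟨-, h⟩
    · have := hv.1 rfl
      simp only [hA] at this
      omega
    · cases h

theorem le_of_refines (hjn : j < n) {s t : Elt_s12} (h : refines (rel n j s) (rel n j t)) :
    le n s t := by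
  have hb : ∀ k, Sum.inl (fun _ => Set.univ) ∈ dom (rel n j (b k)) := fun k =>
    mem_dom_rel_b.2 ⟨admissible_univ, zq, trivial⟩
  have he : ∀ k, Sum.inl (fun _ => Set.univ) ∈ dom (rel n j (e k)) := fun k =>
    mem_dom_rel_e.2 ⟨admissible_univ, zq, trivial, q, Or.inr ⟨rfl, rfl⟩⟩
  have hg : Sum.inr zq ∈ dom (rel n j g) :=
    ⟨Sum.inr q, mem_rel_g.2 ⟨zq, q, Or.inr ⟨rfl, rfl⟩, rfl, rfl⟩⟩
  cases t with
  | zero => exact Or.inr (Or.inl rfl)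
  | g =>
    obtain ⟨y, hy⟩ := h.1 hg
    cases s <;> simp_all [le]
  | b k =>
    obtain ⟨y, hy⟩ := h.1 (hb k)
    cases s with
    | zero => exact hy.elim
    | g => simp at hy
    | b i => exact le_of_refines_b_b h
    | e i => exact le_of_refines_e_b h
  | e k =>
    obtain ⟨y, hy⟩ := h.1 (he k)
    cases s with
    | zero => exact hy.elim
    | g => simp at hy
    | b i =>
      have := h.2 (Sum.inl (fun _ => Set.univ), Sum.inr zq)
        (mem_rel_b.2 ⟨_, zq, admissible_univ, trivial, rfl, rfl⟩) (he k)
      obtain ⟨β, v, w, -, -, hw, -, h2⟩ := mem_rel_e.1 this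
      cases h2
      rcases hw with ⟨-, h⟩ | ⟨-, h⟩ <;> cases h
    | e i => exact le_of_refines_e_e hjn h

end Elt_s12

/-- The `L`-structure with a given order and composition. -/
@[reducible]
def binStructure {M : Type} (le : M → M → Prop) (op : M → M → M) : L.Structure M where
  funMap {k} := match k with
    | 0 => fun f => nomatch f
    | 1 => fun f => nomatch f
    | 2 => fun _ v => op (v 0) (v 1)
    | _ + 3 => fun f => nomatch f
  RelMap {k} := match k with
    | 0 => fun f => nomatch f
    | 1 => fun f => nomatch f
    | 2 => fun _ v => le (v 0) (v 1)
    | _ + 3 => fun f => nomatch f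

open Filter FirstOrder.Language

/-- The carrier of the `n`-th structure. -/
def EltAt (_ : ℕ) : Type := Elt_s12

instance eltStructure (n : ℕ) : L.Structure (EltAt n) :=
  binStructure (M := Elt_s12) (Elt_s12.le n) Elt_s12.op

instance (n : ℕ) : Nonempty (EltAt n) := ⟨Elt_s12.zero⟩

/-- The ultraproduct of the structures on `Elt`. -/
abbrev EltUltraproduct : Type := (hyperfilter ℕ : Filter ℕ).Product EltAt

/-- The class of a sequence in the ultraproduct. -/
noncomputable def toEltUltraproduct (s : ℕ → Elt_s12) : EltUltraproduct :=
  Quotient.mk ((hyperfilter ℕ : Filter ℕ).productSetoid EltAt) s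

theorem leOf_eltUltraproduct (s t : ℕ → Elt_s12) :
    leOf EltUltraproduct Ultraproduct.structure (toEltUltraproduct s) (toEltUltraproduct t) ↔
      ∀ᶠ n in hyperfilter ℕ, Elt_s12.le n (s n) (t n) := by
  have := relMap_quotient_mk' (s := (hyperfilter ℕ : Filter ℕ).productSetoid EltAt)
    (ps := Ultraproduct.setoidPrestructure (L := L) EltAt (hyperfilter ℕ))
    (n := 2) (() : L.Relations 2) ![s, t]
  refine Iff.trans (iff_of_eq ?_) this
  unfold leOf
  congr 1
  ext i
  fin_cases i <;> rfl

theorem opOf_eltUltraproduct (s t : ℕ → Elt_s12) :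
    opOf EltUltraproduct Ultraproduct.structure (toEltUltraproduct s) (toEltUltraproduct t) =
      toEltUltraproduct fun n => Elt_s12.op (s n) (t n) := by
  have := Ultraproduct.funMap_cast (L := L) (M := EltAt) (u := hyperfilter ℕ)
    (n := 2) (() : L.Functions 2) ![s, t]
  refine Eq.trans ?_ this
  unfold opOf
  congr 1
  ext i
  fin_cases i <;> rfl

theorem eventually_eventually_refines {s t : ℕ → Elt_s12} :
    (∀ᶠ j in hyperfilter ℕ, ∀ᶠ n in hyperfilter ℕ,
      refines (Elt_s12.rel n j (s n)) (Elt_s12.rel n j (t n))) ↔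
    ∀ᶠ n in hyperfilter ℕ, Elt_s12.le n (s n) (t n) := by
  have hlt : ∀ j : ℕ, ∀ᶠ n in hyperfilter ℕ, j < n := fun j =>
    Nat.hyperfilter_le_atTop (eventually_gt_atTop j)
  constructor
  · intro h
    obtain ⟨j, hj⟩ := h.exists
    filter_upwards [hj, hlt j] with n h1 h2
    exact Elt_s12.le_of_refines h2 h1
  · intro h
    have hsep : ∀ᶠ j in hyperfilter ℕ, ∀ᶠ n in hyperfilter ℕ,
        ¬ (s n = Elt_s12.e j ∧ t n = Elt_s12.b (j + 1)) := by
      by_cases hex : ∃ j, ∀ᶠ n in hyperfilter ℕ, s n = Elt_s12.e j ∧ t n = Elt_s12.b (j + 1)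
      · obtain ⟨j, hj⟩ := hex
        filter_upwards [hlt j] with j' hj'
        refine hj.mono fun n hn hn' => ?_
        have := hn.1.symm.trans hn'.1
        injection this
        omega
      · exact Eventually.of_forall fun j => Ultrafilter.eventually_not.2 fun hj => hex ⟨j, hj⟩
    filter_upwards [hsep] with j hj
    filter_upwards [h, hj] with n h1 h2
    exact Elt_s12.refines_rel h1 h2

theorem representable_eltUltraproduct :
    Representable EltUltraproduct (leOf EltUltraproduct Ultraproduct.structure)
      (opOf EltUltraproduct Ultraproduct.structure) := by
  set W : Ultrafilter (ℕ × ℕ) :=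
    (hyperfilter ℕ).bind fun j => (hyperfilter ℕ).map (Prod.mk j)
  have hWe : ∀ P : ℕ × ℕ → Prop, (∀ᶠ w in W, P w) ↔
      ∀ᶠ j in hyperfilter ℕ, ∀ᶠ n in hyperfilter ℕ, P (j, n) := fun P => Iff.rfl
  set η : (ℕ → Elt_s12) → Set ((ℕ × ℕ → Elt_s12.Pt) × (ℕ × ℕ → Elt_s12.Pt)) := fun s =>
    ultraRel W fun w => Elt_s12.rel w.2 w.1 (s w.2)
  have hcongr : ∀ s t : ℕ → Elt_s12, (∀ᶠ n in hyperfilter ℕ, s n = t n) → η s = η t :=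
    fun s t h => ultraRel_congr ((hWe _).2 (Eventually.of_forall fun j =>
      h.mono fun n hn => by simp only [hn]))
  refine ⟨ℕ × ℕ → Elt_s12.Pt, Quotient.lift η hcongr, ?_, ?_⟩
  · intro a b
    induction a using Quotient.inductionOn' with | h s
    induction b using Quotient.inductionOn' with | h t
    refine (leOf_eltUltraproduct s t).trans ?_
    refine Iff.trans ?_ refines_ultraRel.symm
    exact eventually_eventually_refines.symm
  · intro a b
    induction a using Quotient.inductionOn' with | h s
    induction b using Quotient.inductionOn' with | h t
    refine (congrArg _ (opOf_eltUltraproduct s t)).trans (Eq.trans ?_ ultraRel_rcomp)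
    exact ultraRel_congr (Eventually.of_forall fun w => Elt_s12.rel_op _ _)

/-- Theorem 2: the class `R(⊑, ;)` is not finitely axiomatisable — no single
first-order sentence (equivalently, no finite set of first-order sentences, by
taking the conjunction) in the language of one binary relation symbol and one
binary function symbol holds in exactly the representable structures. -/
theorem stmt12 :
    ¬ ∃ φ : L.Sentence, ∀ (M : Type) (str : L.Structure M),
      (@FirstOrder.Language.Sentence.Realize L M str φ ↔
        Representable M (leOf M str) (opOf M str)) := by
  rintro ⟨φ, hφ⟩
  have h := (hφ EltUltraproduct Ultraproduct.structure).2 representable_eltUltraproduct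
  have h' := (Ultraproduct.sentence_realize (M := EltAt) (u := hyperfilter ℕ) φ).1 h
  obtain ⟨n, hn, hpos⟩ :=
    (h'.and (Nat.hyperfilter_le_atTop (eventually_gt_atTop 0))).exists
  exact Elt_s12.not_representable hpos ((hφ (EltAt n) (eltStructure n)).1 hn)
end

section
/- (Completeness direction of Proposition 1.) Let (S, ·, ∘) be a structure where · is associative, commutative, and idempotent (a meet-semilattice), ∘ is associative, and ∘ is monotone with respect to the order a ≤ b iff a·b = a (i.e., a ≤ a' and b ≤ b' imply a∘b ≤ a'∘b'). Then there exist a set X and a map θ from S to binary relations on X such that for all a,b ∈ S: θ(a·b) = θ(a) ∩ θ(b), θ(a∘b) = θ(a);θ(b), and a ≤ b iff θ(a) ⊆ θ(b). -/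
/-- A semigroup with an adjoined identity `one` and an absorbing element `top`. -/
inductive WithOneTop (S : Type*) where
  | one : WithOneTop S
  | top : WithOneTop S
  | of : S → WithOneTop S

namespace WithOneTop

variable {S : Type*}

/-- Multiplication with `one` neutral and `top` absorbing. -/
protected def mul [Mul S] : WithOneTop S → WithOneTop S → WithOneTop S
  | one, p => p
  | top, _ => top
  | of a, one => of a
  | of _, top => top
  | of a, of b => of (a * b)

/-- The order with `top` greatest and `one` incomparable to the elements of `S`. -/
protected def le [LE S] : WithOneTop S → WithOneTop S → Prop
  | _, top => True
  | one, one => True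
  | of a, of b => a ≤ b
  | _, _ => False

instance [Mul S] : Mul (WithOneTop S) := ⟨WithOneTop.mul⟩

instance [LE S] : LE (WithOneTop S) := ⟨WithOneTop.le⟩

instance [Semigroup S] : Monoid (WithOneTop S) where
  one := one
  one_mul p := rfl
  mul_one p := by cases p <;> rfl
  mul_assoc p q r := by
    cases p <;> cases q <;> cases r <;> first | rfl | exact congrArg of (mul_assoc _ _ _)

instance [Preorder S] : Preorder (WithOneTop S) where
  le_refl p := by cases p <;> first | exact trivial | exact le_refl (α := S) _
  le_trans p q r := by
    cases p <;> cases q <;> cases r <;> intro h k <;>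
      first | exact trivial | exact h.elim | exact k.elim | exact le_trans (α := S) h k

theorem le_top [LE S] (p : WithOneTop S) : p ≤ top := by cases p <;> exact trivial

theorem of_le_of [LE S] {a b : S} : of a ≤ of b ↔ a ≤ b := Iff.rfl

theorem top_mul [Mul S] (p : WithOneTop S) : top * p = top := rfl

theorem mul_top [Mul S] (p : WithOneTop S) : p * top = top := by cases p <;> rfl

theorem of_mul_of [Mul S] (a b : S) : of a * of b = of (a * b) := rfl

theorem eq_top_of_top_le [LE S] {p : WithOneTop S} (h : top ≤ p) : p = top := by
  cases p <;> first | rfl | exact h.elim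

theorem eq_top_of_one_le_of_mul [Semigroup S] [LE S] {a : S} {p : WithOneTop S}
    (h : 1 ≤ of a * p) : p = top := by
  cases p <;> first | rfl | exact h.elim

theorem le_of_inf [SemilatticeInf S] {p : WithOneTop S} {a b : S} :
    p ≤ of (a ⊓ b) ↔ p ≤ of a ∧ p ≤ of b := by
  cases p with
  | one => exact ⟨fun h => h.elim, fun h => h.1.elim⟩
  | top => exact ⟨fun h => h.elim, fun h => h.1.elim⟩
  | of c => exact le_inf_iff (α := S)

theorem mul_le_mul [Semigroup S] [Preorder S] [MulLeftMono S] [MulRightMono S]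
    {p p' q q' : WithOneTop S} (hp : p ≤ p') (hq : q ≤ q') : p * q ≤ p' * q' := by
  cases p <;> cases p' <;> cases q <;> cases q' <;>
    first
    | exact hp.elim
    | exact hq.elim
    | exact hp
    | exact hq
    | exact trivial
    | exact _root_.mul_le_mul' (α := S) hp hq

end WithOneTop

/-- Points of the representation: two endpoints for each element of `S`, and a candidate
midpoint `mid x y a b` for factoring the pair `(x, y)` through `a` and `b`. -/
inductive RepNode (S : Type*) where
  | base : S → Bool → RepNode S
  | mid : RepNode S → RepNode S → S → S → RepNode S

namespace RepNode

variable {S : Type*}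

/-- A rank for which a midpoint exceeds the sum of the ranks of its endpoints. -/
def rank : RepNode S → ℕ
  | base _ _ => 0
  | mid x y _ _ => x.rank + y.rank + 1

theorem eq_base_of_rank_eq_zero {u : RepNode S} (h : u.rank = 0) :
    ∃ c i, u = base c i := by
  cases u with
  | base c i => exact ⟨c, i, rfl⟩
  | mid x y a b => simp [rank] at h

variable [Semigroup S] [SemilatticeInf S]

open Classical in
/-- The `WithOneTop S`-valued distance between nodes. -/
noncomputable def dist : RepNode S → RepNode S → WithOneTop S
  | base c i, base d j =>
    if base c i = base d j then 1 else if c = d ∧ i = false ∧ j = true then .of c else .top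
  | base c i, mid x y a b =>
    if dist x y ≤ .of (a * b) then dist (base c i) x * .of a else .top
  | mid x y a b, base d j =>
    if dist x y ≤ .of (a * b) then .of b * dist y (base d j) else .top
  | mid x y a b, mid x' y' a' b' =>
    if mid x y a b = mid x' y' a' b' then 1
    else if x.rank + y.rank ≤ x'.rank + y'.rank then
      if dist x' y' ≤ .of (a' * b') then dist (mid x y a b) x' * .of a' else .top
    else
      if dist x y ≤ .of (a * b) then .of b * dist y (mid x' y' a' b') else .top
termination_by u v => u.rank + v.rank
decreasing_by all_goals simp only [rank]; omega

theorem dist_self (u : RepNode S) : dist u u = 1 := by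
  cases u <;> simp [dist]

theorem dist_mid_right {u x y : RepNode S} {a b : S} (hr : u.rank ≤ (mid x y a b).rank)
    (hne : u ≠ mid x y a b) (h : dist x y ≤ .of (a * b)) :
    dist u (mid x y a b) = dist u x * .of a := by
  cases u with
  | base c i => rw [dist, if_pos h]
  | mid x' y' a' b' =>
    rw [dist, if_neg hne, if_pos (by simpa [rank] using hr), if_pos h]

theorem dist_mid_right_eq_top {u x y : RepNode S} {a b : S} (hr : u.rank ≤ (mid x y a b).rank)
    (hne : u ≠ mid x y a b) (h : ¬ dist x y ≤ .of (a * b)) :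
    dist u (mid x y a b) = .top := by
  cases u with
  | base c i => rw [dist, if_neg h]
  | mid x' y' a' b' =>
    rw [dist, if_neg hne, if_pos (by simpa [rank] using hr), if_neg h]

theorem dist_mid_left_of_lt {v x y : RepNode S} {a b : S} (hr : v.rank < (mid x y a b).rank)
    (h : dist x y ≤ .of (a * b)) :
    dist (mid x y a b) v = .of b * dist y v := by
  cases v with
  | base c i => rw [dist, if_pos h]
  | mid x' y' a' b' =>
    rw [dist, if_neg (by intro he; simp [he] at hr), if_neg (by simpa [rank] using hr), if_pos h]

theorem dist_mid_left_eq_top_of_lt {v x y : RepNode S} {a b : S}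
    (hr : v.rank < (mid x y a b).rank) (h : ¬ dist x y ≤ .of (a * b)) :
    dist (mid x y a b) v = .top := by
  cases v with
  | base c i => rw [dist, if_neg h]
  | mid x' y' a' b' =>
    rw [dist, if_neg (by intro he; simp [he] at hr), if_neg (by simpa [rank] using hr), if_neg h]

theorem dist_mid_left {v x y : RepNode S} {a b : S} (hr : v.rank ≤ (mid x y a b).rank)
    (hne : mid x y a b ≠ v) (h : dist x y ≤ .of (a * b)) :
    dist (mid x y a b) v = .of b * dist y v := by
  rcases hr.lt_or_eq with hlt | heq
  · exact dist_mid_left_of_lt hlt h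
  cases v with
  | base c i => simp [rank] at heq
  | mid x' y' a' b' =>
    have hy : y.rank < (mid x' y' a' b').rank := by rw [heq]; simp only [rank]; omega
    have hx' : x'.rank < (mid x y a b).rank := by rw [← heq]; simp only [rank]; omega
    have hy' : y ≠ mid x' y' a' b' := fun he => by simp [← he] at hy
    by_cases h' : dist x' y' ≤ .of (a' * b')
    · rw [dist_mid_right heq.ge hne h', dist_mid_left_of_lt hx' h, dist_mid_right hy.le hy' h',
        mul_assoc]
    · rw [dist_mid_right_eq_top heq.ge hne h', dist_mid_right_eq_top hy.le hy' h',
        WithOneTop.mul_top]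

theorem dist_mid_left_eq_top {v x y : RepNode S} {a b : S} (hr : v.rank ≤ (mid x y a b).rank)
    (hne : mid x y a b ≠ v) (h : ¬ dist x y ≤ .of (a * b)) :
    dist (mid x y a b) v = .top := by
  rcases hr.lt_or_eq with hlt | heq
  · exact dist_mid_left_eq_top_of_lt hlt h
  cases v with
  | base c i => simp [rank] at heq
  | mid x' y' a' b' =>
    have hx' : x'.rank < (mid x y a b).rank := by rw [← heq]; simp only [rank]; omega
    by_cases h' : dist x' y' ≤ .of (a' * b')
    · rw [dist_mid_right heq.ge hne h', dist_mid_left_eq_top_of_lt hx' h, WithOneTop.top_mul]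
    · exact dist_mid_right_eq_top heq.ge hne h'

theorem dist_triangle_base {w u v : RepNode S} (hw : w.rank = 0) (hu : u.rank = 0) (hv : v.rank = 0)
    (hwu : w ≠ u) (huv : u ≠ v) : dist w v ≤ dist w u * dist u v := by
  obtain ⟨c, i, rfl⟩ := eq_base_of_rank_eq_zero hw
  obtain ⟨d, j, rfl⟩ := eq_base_of_rank_eq_zero hu
  obtain ⟨e, k, rfl⟩ := eq_base_of_rank_eq_zero hv
  have h : dist (base c i) (base d j) * dist (base d j) (base e k) = .top := by
    rw [dist, dist, if_neg hwu, if_neg huv]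
    cases j <;> simp [WithOneTop.top_mul, WithOneTop.mul_top]
  rw [h]
  exact WithOneTop.le_top _

theorem dist_triangle [MulLeftMono S] [MulRightMono S] (w u v : RepNode S) :
    dist w v ≤ dist w u * dist u v := by
  induction hn : w.rank + u.rank + v.rank using Nat.strong_induction_on generalizing w u v with
  | _ n ih =>
  subst hn
  by_cases hwu : w = u
  · rw [hwu, dist_self, one_mul]
  by_cases huv : u = v
  · rw [huv, dist_self, mul_one]
  by_cases hu : w.rank ≤ u.rank ∧ v.rank ≤ u.rank
  · cases u with
    | base c i =>
      exact dist_triangle_base (Nat.le_zero.1 hu.1) rfl (Nat.le_zero.1 hu.2) hwu huv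
    | mid x y a b =>
      by_cases h : dist x y ≤ .of (a * b)
      · rw [dist_mid_right hu.1 hwu h, dist_mid_left hu.2 huv h]
        calc dist w v ≤ dist w y * dist y v := ih _ (by simp only [rank]; omega) _ _ _ rfl
          _ ≤ (dist w x * dist x y) * dist y v :=
            WithOneTop.mul_le_mul (ih _ (by simp only [rank]; omega) _ _ _ rfl) le_rfl
          _ ≤ (dist w x * (.of a * .of b)) * dist y v :=
            WithOneTop.mul_le_mul (WithOneTop.mul_le_mul le_rfl h) le_rfl
          _ = _ := by simp only [mul_assoc]
      · rw [dist_mid_right_eq_top hu.1 hwu h, WithOneTop.top_mul]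
        exact WithOneTop.le_top _
  by_cases hwv : w = v
  · subst hwv
    have hr : u.rank ≤ w.rank := by omega
    rw [dist_self]
    cases w with
    | base c i => exact absurd ⟨Nat.zero_le _, Nat.zero_le _⟩ hu
    | mid x y a b =>
      by_cases h : dist x y ≤ .of (a * b)
      · have hyx : dist y x = .top := by
          have h1 : dist x x ≤ dist x y * dist y x :=
            ih _ (by simp only [rank]; omega) _ _ _ rfl
          rw [dist_self] at h1
          exact WithOneTop.eq_top_of_one_le_of_mul (h1.trans (WithOneTop.mul_le_mul h le_rfl))
        have h2 : dist y x ≤ dist y u * dist u x := ih _ (by simp only [rank]; omega) _ _ _ rfl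
        rw [hyx] at h2
        have h3 := WithOneTop.eq_top_of_top_le h2
        rw [dist_mid_left hr hwu h, dist_mid_right hr huv h, mul_assoc, ← mul_assoc (dist y u),
          h3, WithOneTop.top_mul, WithOneTop.mul_top]
        exact WithOneTop.le_top _
      · rw [dist_mid_left_eq_top hr hwu h, WithOneTop.top_mul]
        exact WithOneTop.le_top _
  rcases le_total w.rank v.rank with hr | hr
  · have hr' : u.rank ≤ v.rank := by omega
    cases v with
    | base c i => exact absurd ⟨hr.trans (Nat.zero_le _), Nat.zero_le _⟩ hu
    | mid x y a b =>
      by_cases h : dist x y ≤ .of (a * b)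
      · rw [dist_mid_right hr hwv h, dist_mid_right hr' huv h, ← mul_assoc]
        exact WithOneTop.mul_le_mul (ih _ (by simp only [rank]; omega) _ _ _ rfl) le_rfl
      · rw [dist_mid_right_eq_top hr' huv h, WithOneTop.mul_top]
        exact WithOneTop.le_top _
  · have hr' : u.rank ≤ w.rank := by omega
    cases w with
    | base c i => exact absurd ⟨Nat.zero_le _, hr.trans (Nat.zero_le _)⟩ hu
    | mid x y a b =>
      by_cases h : dist x y ≤ .of (a * b)
      · rw [dist_mid_left hr hwv h, dist_mid_left hr' hwu h, mul_assoc]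
        exact WithOneTop.mul_le_mul le_rfl (ih _ (by simp only [rank]; omega) _ _ _ rfl)
      · rw [dist_mid_left_eq_top hr' hwu h, WithOneTop.top_mul]
        exact WithOneTop.le_top _

theorem exists_dist_le_of [MulLeftMono S] [MulRightMono S] {u v : RepNode S} {a b : S} :
    dist u v ≤ .of (a * b) ↔ ∃ z, dist u z ≤ .of a ∧ dist z v ≤ .of b := by
  constructor
  · intro h
    have hu : u.rank < (mid u v a b).rank := by simp only [rank]; omega
    have hv : v.rank < (mid u v a b).rank := by simp only [rank]; omega
    refine ⟨mid u v a b, ?_, ?_⟩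
    · rw [dist_mid_right hu.le (fun he => by simp [← he] at hu) h, dist_self, one_mul]
    · rw [dist_mid_left_of_lt hv h, dist_self, mul_one]
  · rintro ⟨z, h1, h2⟩
    exact (dist_triangle u z v).trans (WithOneTop.mul_le_mul h1 h2)

theorem dist_base (a : S) : dist (base a false) (base a true) = .of a := by
  simp [dist]

end RepNode

/-- Every semilattice-ordered semigroup embeds into the binary relations on some set. -/
theorem exists_relation_representation (S : Type*) [Semigroup S] [SemilatticeInf S]
    [MulLeftMono S] [MulRightMono S] :
    ∃ θ : S → Set (RepNode S × RepNode S),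
      (∀ a b, θ (a ⊓ b) = θ a ∩ θ b) ∧
      (∀ a b, θ (a * b) = rcomp (θ a) (θ b)) ∧
      (∀ a b, a ≤ b ↔ θ a ⊆ θ b) := by
  refine ⟨fun a => {p | RepNode.dist p.1 p.2 ≤ .of a},
    fun a b => ?_, fun a b => ?_, fun a b => ?_⟩
  · ext p
    exact WithOneTop.le_of_inf
  · ext p
    exact RepNode.exists_dist_le_of
  · refine ⟨fun h p hp => le_trans (α := WithOneTop S) hp (WithOneTop.of_le_of.2 h), fun h => ?_⟩
    have hab : RepNode.dist (.base a false) (.base a true) ≤ .of b :=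
      @h (.base a false, .base a true) (RepNode.dist_base a).le
    rwa [RepNode.dist_base, WithOneTop.of_le_of] at hab

/-- Completeness direction of Proposition 1: every associative, monotone
meet-semilattice with composition `(·, ∘)` has a `(∩, ;)`-representation,
faithful for the semilattice order `a ≤ b ↔ a·b = a`. -/
theorem stmt13 (S : Type) (meet : S → S → S) (op : S → S → S)
    (hmassoc : ∀ a b c, meet (meet a b) c = meet a (meet b c))
    (hmcomm : ∀ a b, meet a b = meet b a)
    (hmidem : ∀ a, meet a a = a)
    (hassoc : ∀ a b c, op (op a b) c = op a (op b c))
    (hmono : ∀ a a' b b', meet a a' = a → meet b b' = b →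
      meet (op a b) (op a' b') = op a b) :
    ∃ (X : Type) (θ : S → Set (X × X)),
      (∀ a b, θ (meet a b) = θ a ∩ θ b) ∧
      (∀ a b, θ (op a b) = rcomp (θ a) (θ b)) ∧
      (∀ a b, meet a b = a ↔ θ a ⊆ θ b) := by
  let _ : Semigroup S := { mul := op, mul_assoc := hassoc }
  let _ : SemilatticeInf S :=
    { le := fun a b => meet a b = a
      inf := meet
      le_refl := hmidem
      le_trans := fun a b c hab hbc => by
        rw [← hab, hmassoc, hbc]
      le_antisymm := fun a b hab hba => by rw [← hab, hmcomm]; exact hba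
      inf_le_left := fun a b => by
        rw [hmcomm, ← hmassoc, hmidem]
      inf_le_right := fun a b => by
        rw [hmassoc, hmidem]
      le_inf := fun a b c hab hac => by
        rw [← hmassoc, hab, hac] }
  have : MulLeftMono S := ⟨fun a _ _ h => hmono a a _ _ (hmidem a) h⟩
  have : MulRightMono S := ⟨fun a _ _ h => hmono _ _ a a h (hmidem a)⟩
  exact ⟨RepNode S, exists_relation_representation S⟩
end

section
/- Let X be a set and let E, G, N be binary relations on X satisfying G;E = G, E;G = G, G;G ⊆ G, E ⊆ N, G ∩ N = ∅, N ⊆ N;G, and N ≠ ∅. Then for every natural number n there exist x ∈ X and pairwise distinct points y_0, …, y_n ∈ X such that (x, y_i) ∈ N for all i ≤ n, and (y_j, y_i) ∈ G for all i < j ≤ n. -/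
/-- If `G` is disjoint from a relation containing `E`, and `E` is a two-sided identity for `G`,
then `G` is irreflexive. -/
theorem notMem_diag_of_rcomp_eq {X : Type*} {E G N : Set (X × X)}
    (hGE : rcomp G E = G) (hEG : rcomp E G = G) (hEN : E ⊆ N) (hGN : G ∩ N = ∅) (y : X) :
    (y, y) ∉ G := by
  intro hy
  obtain ⟨z, -, hzE⟩ := hGE.ge hy
  have hzG : (z, y) ∈ G := hEG.le ⟨y, hzE, hy⟩
  exact Set.eq_empty_iff_forall_notMem.mp hGN _ ⟨hzG, hEN hzE⟩

/-- If `N ⊆ N;G` with `G` transitive, then every pair `(x, y)` in `N` starts a sequence of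
`N`-successors of `x` that descends along `G`. -/
theorem exists_seq_of_subset_rcomp {X : Type*} {G N : Set (X × X)}
    (hGG : rcomp G G ⊆ G) (hNNG : N ⊆ rcomp N G) {x y : X} (hxy : (x, y) ∈ N) :
    ∃ s : ℕ → X, (∀ n, (x, s n) ∈ N) ∧ ∀ i j, i < j → (s j, s i) ∈ G := by
  have step (a : {a // (x, a) ∈ N}) : ∃ b : {b // (x, b) ∈ N}, (b.1, a.1) ∈ G :=
    let ⟨b, hb, hba⟩ := hNNG a.2
    ⟨⟨b, hb⟩, hba⟩
  choose f hf using step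
  let s : ℕ → {a // (x, a) ∈ N} := fun n => f^[n] ⟨y, hxy⟩
  have hs (n : ℕ) : ((s (n + 1)).1, (s n).1) ∈ G := by
    simpa only [s, Function.iterate_succ_apply'] using hf (s n)
  refine ⟨fun n => (s n).1, fun n => (s n).2, fun i j hij => ?_⟩
  induction j, hij using Nat.le_induction with
  | base => exact hs i
  | succ j _ ih => exact hGG ⟨_, hs j, ih⟩

/-- Claim 2 in the proof of Proposition 2: under the listed hypotheses, for
every `n` there are `x` and pairwise distinct `y₀, …, yₙ` with `(x, yᵢ) ∈ N`
for all `i ≤ n` and `(yⱼ, yᵢ) ∈ G` for all `i < j ≤ n`. -/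
theorem stmt15 {X : Type*} (E G N : Set (X × X))
    (hGE : rcomp G E = G) (hEG : rcomp E G = G) (hGG : rcomp G G ⊆ G)
    (hEN : E ⊆ N) (hGN : G ∩ N = ∅) (hNNG : N ⊆ rcomp N G) (hN : N ≠ ∅) :
    ∀ n : ℕ, ∃ (x : X) (y : Fin (n + 1) → X), Function.Injective y ∧
      (∀ i, (x, y i) ∈ N) ∧ ∀ i j : Fin (n + 1), i < j → (y j, y i) ∈ G := by
  obtain ⟨⟨x, y⟩, hxy⟩ := Set.nonempty_iff_ne_empty.mpr hN
  obtain ⟨s, hsN, hsG⟩ := exists_seq_of_subset_rcomp hGG hNNG hxy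
  have hs : Function.Injective s := Function.Injective.of_lt_imp_ne fun i j hij h =>
    notMem_diag_of_rcomp_eq hGE hEG hEN hGN (s i) (by simpa only [h] using hsG i j hij)
  exact fun n => ⟨x, fun i => s i, hs.comp Fin.val_injective, fun i => hsN i,
    fun i j hij => hsG i j hij⟩
end

section
/- (Proposition 2, conclusion.) Let X be a set and let E, G, N be binary relations on X satisfying G;E = G, E;G = G, G;G ⊆ G, E ⊆ N, G ∩ N = ∅, N ⊆ N;G, and N ≠ ∅. Then X is infinite. Consequently, any (⊆,\,;)-representation of the point algebra must have an infinite base, so the point algebra is representable but has no representation over a finite base. -/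
/-- Proposition 2, conclusion: under the hypotheses satisfied by the relations
`E = θ(e)`, `G = θ(g)`, `N = θ(−g)` in any `(⊆, ∖, ;)`-representation of the
point algebra, the base set `X` must be infinite.  Consequently the point
algebra, though representable (over ℚ), has no representation over a finite
base. -/
theorem stmt16 {X : Type*} (E G N : Set (X × X))
    (hGE : rcomp G E = G) (hEG : rcomp E G = G) (hGG : rcomp G G ⊆ G)
    (hEN : E ⊆ N) (hGN : G ∩ N = ∅) (hNNG : N ⊆ rcomp N G) (hN : N ≠ ∅) :
    Infinite X := by
  by_contra hX
  have : Finite X := not_infinite_iff_finite.mp hX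
  let r : X → X → Prop := fun a b => (a, b) ∈ G
  have : IsTrans X r := ⟨fun a b c hab hbc => hGG ⟨b, hab, hbc⟩⟩
  have : Std.Irrefl r := ⟨fun y (hy : (y, y) ∈ G) => by
    obtain ⟨z, -, hzy⟩ : (y, y) ∈ rcomp G E := hGE.symm ▸ hy
    have hG : (z, y) ∈ G := hEG ▸ (⟨y, hzy, hy⟩ : (z, y) ∈ rcomp E G)
    exact Set.disjoint_left.mp (Set.disjoint_iff_inter_eq_empty.mpr hGN) hG (hEN hzy)⟩
  have hwf : WellFounded r := Finite.wellFounded_of_trans_of_irrefl r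
  obtain ⟨⟨x, y⟩, hxy⟩ := Set.nonempty_iff_ne_empty.mpr hN
  obtain ⟨m, hm, hmin⟩ := hwf.has_min {y | (x, y) ∈ N} ⟨y, hxy⟩
  obtain ⟨z, hxz, hzm⟩ := hNNG hm
  exact hmin z hxz hzm
end

section
/- (Zareckii-style representation.) Let (S,≤,∘) be an ordered semigroup: ≤ is a partial order, ∘ is associative, and ∘ is monotone in both arguments. Let S' = S ∪ {e} be obtained by adjoining a new two-sided identity element e with e∘x = x = x∘e for all x ∈ S', e ≤ e, and x ≰ e, e ≰ x for all x ∈ S. Define θ(s) = {(x,y) ∈ S'×S' : y ≤ x∘s} for s ∈ S. Then θ is a (⊆,;)-representation of S: for all s,t ∈ S, s ≤ t iff θ(s) ⊆ θ(t), and θ(s∘t) = θ(s);θ(t). -/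
/-- The extension `S' = S ∪ {e}` of a structure by a new two-sided identity
element `e = none`. -/
def opExt {S : Type*} (op : S → S → S) : Option S → Option S → Option S
  | none, y => y
  | x, none => x
  | some a, some b => some (op a b)

/-- The order on `S' = S ∪ {e}`: the order of `S` on old elements, `e ≤ e`,
and `e` incomparable with every element of `S`. -/
def leExt {S : Type*} (le : S → S → Prop) : Option S → Option S → Prop
  | some a, some b => le a b
  | none, none => True
  | _, _ => False

/-- The Zareckii-style map `θ(s) = {(x, y) ∈ S' × S' : y ≤ x ∘ s}`. -/
def zar {S : Type*} (le : S → S → Prop) (op : S → S → S) (s : S) :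
    Set (Option S × Option S) :=
  {p | leExt le p.2 (opExt op p.1 (some s))}

/-- Zareckii-style representation: for an ordered semigroup `(S, ≤, ∘)`, the map
`θ(s) = {(x, y) : y ≤ x ∘ s}` over the base `S' = S ∪ {e}` is a faithful
`(⊆, ;)`-representation. -/
theorem stmt17 {S : Type*} (le : S → S → Prop) (op : S → S → S)
    (hrefl : ∀ a, le a a)
    (hantisymm : ∀ a b, le a b → le b a → a = b)
    (htrans : ∀ a b c, le a b → le b c → le a c)
    (hassoc : ∀ a b c, op (op a b) c = op a (op b c))
    (hmono : ∀ a a' b b', le a a' → le b b' → le (op a b) (op a' b')) :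
    (∀ s t : S, le s t ↔ zar le op s ⊆ zar le op t) ∧
    (∀ s t : S, zar le op (op s t) = rcomp (zar le op s) (zar le op t)) := by
  refine ⟨fun s t => ⟨?_, fun h => ?_⟩, fun s t => Set.ext ?_⟩
  · rintro hst ⟨_ | x, _ | y⟩ hxy
    · exact hxy
    · exact htrans y s t hxy hst
    · exact hxy
    · exact htrans _ _ _ hxy (hmono _ _ _ _ (hrefl x) hst)
  · have hs : ((none, some s) : Option S × Option S) ∈ zar le op s := hrefl s
    exact h hs
  · rintro ⟨x, y⟩
    constructor
    · intro hxy
      cases x with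
      | none => exact ⟨some s, hrefl s, hxy⟩
      | some x =>
        refine ⟨some (op x s), hrefl (op x s), ?_⟩
        cases y with
        | none => exact hxy
        | some y =>
          change le y (op (op x s) t)
          rw [hassoc]
          exact hxy
    · rintro ⟨_ | z, hxz, hzy⟩
      · cases x <;> exact hxz.elim
      · cases y with
        | none => exact hzy.elim
        | some y =>
          cases x with
          | none => exact htrans _ _ _ hzy (hmono _ _ _ _ hxz (hrefl t))
          | some x =>
            change le y (op x (op s t))
            rw [← hassoc]
            exact htrans _ _ _ hzy (hmono _ _ _ _ hxz (hrefl t))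
end

section
/- Let X be a set and let R, S be binary relations on X. Define the demonic join R⊔S = (R∪S)↾(dom(R)∩dom(S)) = {(x,y) ∈ R∪S : x ∈ dom(R) and x ∈ dom(S)}. Then R⊔S is the least upper bound of R and S with respect to demonic refinement ⊑: R ⊑ R⊔S, S ⊑ R⊔S, and for every binary relation T on X, if R ⊑ T and S ⊑ T then R⊔S ⊑ T. Moreover, R ⊑ S if and only if R⊔S = S. -/
/-- Demonic join `R ⊔ S = (R ∪ S)↾(dom R ∩ dom S)`. -/
def djoin {X : Type*} (R S : Set (X × X)) : Set (X × X) :=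
  {p ∈ R ∪ S | p.1 ∈ dom R ∧ p.1 ∈ dom S}

theorem mem_dom_of_mem {X : Type*} {R : Set (X × X)} {p : X × X} (hp : p ∈ R) : p.1 ∈ dom R :=
  ⟨p.2, hp⟩

theorem dom_djoin {X : Type*} (R S : Set (X × X)) : dom (djoin R S) = dom R ∩ dom S := by
  ext x
  constructor
  · rintro ⟨y, -, hR, hS⟩
    exact ⟨hR, hS⟩
  · rintro ⟨⟨y, hy⟩, hS⟩
    exact ⟨y, Or.inl hy, ⟨y, hy⟩, hS⟩

theorem refines_djoin_left {X : Type*} (R S : Set (X × X)) : refines R (djoin R S) := by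
  rw [refines, dom_djoin]
  exact ⟨Set.inter_subset_left, fun p hp hd => ⟨Or.inl hp, hd⟩⟩

theorem refines_djoin_right {X : Type*} (R S : Set (X × X)) : refines S (djoin R S) := by
  rw [refines, dom_djoin]
  exact ⟨Set.inter_subset_right, fun p hp hd => ⟨Or.inr hp, hd⟩⟩

theorem djoin_refines {X : Type*} {R S T : Set (X × X)} (hR : refines R T) (hS : refines S T) :
    refines (djoin R S) T := by
  rw [refines, dom_djoin]
  exact ⟨Set.subset_inter hR.1 hS.1, fun p hp hT => hp.1.elim (hR.2 p · hT) (hS.2 p · hT)⟩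

theorem djoin_eq_right_of_refines {X : Type*} {R S : Set (X × X)} (h : refines R S) :
    djoin R S = S := by
  ext p
  constructor
  · rintro ⟨hR | hS, -, hd⟩
    · exact h.2 p hR hd
    · exact hS
  · intro hp
    exact ⟨Or.inr hp, h.1 (mem_dom_of_mem hp), mem_dom_of_mem hp⟩

/-- The demonic join is the least upper bound for demonic refinement, and
`R ⊑ S` iff `R ⊔ S = S`. -/
theorem stmt18 {X : Type*} (R S : Set (X × X)) :
    refines R (djoin R S) ∧ refines S (djoin R S) ∧
    (∀ T : Set (X × X), refines R T → refines S T → refines (djoin R S) T) ∧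
    (refines R S ↔ djoin R S = S) := by
  refine ⟨refines_djoin_left R S, refines_djoin_right R S, fun T => djoin_refines,
    djoin_eq_right_of_refines, fun h => ?_⟩
  have hR := refines_djoin_left R S
  rwa [h] at hR
end

section
/- Demonic composition of binary relations is associative: for all binary relations R, S, T on a set X, (R*S)*T = R*(S*T). -/
/-- Demonic composition `R * S`. -/
def dcomp {X : Type*} (R S : Set (X × X)) : Set (X × X) :=
  rcomp R S ∩ {p | ∀ z, (p.1, z) ∈ R → z ∈ dom S}

/-- Demonic composition of binary relations is associative. -/
theorem stmt19 {X : Type*} (R S T : Set (X × X)) :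
    dcomp (dcomp R S) T = dcomp R (dcomp S T) := by
  ext ⟨x, y⟩
  constructor
  · rintro ⟨⟨z, ⟨⟨w, hxw, hwz⟩, hS⟩, hzy⟩, hT⟩
    have hT' : ∀ w, (x, w) ∈ R → ∀ z, (w, z) ∈ S → z ∈ dom T :=
      fun w hw z hz => hT z ⟨⟨w, hw, hz⟩, hS⟩
    refine ⟨⟨w, hxw, ⟨z, hwz, hzy⟩, hT' w hxw⟩, fun v hv => ?_⟩
    obtain ⟨u, hu⟩ := hS v hv
    obtain ⟨t, ht⟩ := hT' v hv u hu
    exact ⟨t, ⟨u, hu, ht⟩, hT' v hv⟩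
  · rintro ⟨⟨w, hxw, ⟨z, hwz, hzy⟩, -⟩, hST⟩
    refine ⟨⟨z, ⟨⟨w, hxw, hwz⟩, fun v hv => ?_⟩, hzy⟩, ?_⟩
    · obtain ⟨t, ⟨u, hu, -⟩, -⟩ := hST v hv
      exact ⟨u, hu⟩
    · rintro u ⟨⟨v, hv, hu⟩, -⟩
      obtain ⟨t, -, hT⟩ := hST v hv
      exact hT u hu
end
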